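/- arXiv:1912.09911 — 2 statements merged into one kernel-verified Lean document; each statement's English description precedes it below -/
import Mathlib

section
/- For every element λ of the coroot lattice R^∨ and every y ∈ W, the shadow Sh_𝐲(λ) is contained in Conv(W₀·λ), the convex hull in V of the W₀-orbit of λ (the λ-Weyl polytope). -/
open scoped RealInnerProductSpace
open scoped Classical

noncomputable section

/-- The ambient Euclidean space `V = ℝⁿ`. -/
abbrev V (n : ℕ) : Type := EuclideanSpace ℝ (Fin n)

/-- The data of an irreducible crystallographic (reduced) root system in `ℝⁿ`,
together with a choice of positive roots, simple roots and highest root. -/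
structure RootData (n : ℕ) where
  Φ : Set (V n)
  pos : Set (V n)
  simple : Fin n → V n
  highest : V n
  finite : Φ.Finite
  nonzero : ∀ α ∈ Φ, α ≠ 0
  neg_mem : ∀ α ∈ Φ, -α ∈ Φ
  span_top : Submodule.span ℝ Φ = ⊤
  reflect_mem : ∀ α ∈ Φ, ∀ β ∈ Φ, β - (2 * ⟪α, β⟫ / ⟪α, α⟫) • α ∈ Φ
  crystallographic : ∀ α ∈ Φ, ∀ β ∈ Φ, ∃ m : ℤ, 2 * ⟪α, β⟫ / ⟪α, α⟫ = (m : ℝ)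
  reduced : ∀ α ∈ Φ, ∀ c : ℝ, c • α ∈ Φ → c = 1 ∨ c = -1
  pos_sub : pos ⊆ Φ
  pos_total : ∀ α ∈ Φ, α ∈ pos ∨ -α ∈ pos
  pos_not_neg : ∀ α ∈ pos, -α ∉ pos
  simple_mem : ∀ i, simple i ∈ pos
  simple_indep : LinearIndependent ℝ simple
  pos_combo : ∀ α ∈ pos, ∃ c : Fin n → ℝ, (∀ i, 0 ≤ c i) ∧ α = ∑ i, c i • simple i
  highest_mem : highest ∈ pos
  highest_dominates : ∀ α ∈ pos, ∃ c : Fin n → ℝ, (∀ i, 0 ≤ c i) ∧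
    highest - α = ∑ i, c i • simple i
  irreducible : ∀ A B : Set (Fin n), A ∪ B = Set.univ → A ∩ B = ∅ →
    (∀ i ∈ A, ∀ j ∈ B, ⟪simple i, simple j⟫ = 0) → A = ∅ ∨ B = ∅

variable {n : ℕ}

/-- The coroot `α^∨ = 2α/⟨α,α⟩`. -/
def coroot (α : V n) : V n := (2 / ⟪α, α⟫) • α

/-- The affine hyperplane `H_{α,k} = {v : ⟨α,v⟩ = k}`. -/
def Hy (α : V n) (k : ℝ) : Set (V n) := {v | ⟪α, v⟫ = k}

/-- The closed half-space `{v : ⟨α,v⟩ ≥ k}`. -/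
def Hge (α : V n) (k : ℝ) : Set (V n) := {v | k ≤ ⟪α, v⟫}

/-- The closed half-space `{v : ⟨α,v⟩ ≤ k}`. -/
def Hle (α : V n) (k : ℝ) : Set (V n) := {v | ⟪α, v⟫ ≤ k}

/-- The affine reflection `s_{α,k}` fixing `H_{α,k}` pointwise. -/
def sRefl (α : V n) (k : ℝ) : V n → V n := fun v => v - (⟪α, v⟫ - k) • coroot α

/-- The coroot lattice `R^∨ = ⊕ᵢ ℤ αᵢ^∨`. -/
def corootLattice (D : RootData n) : Set (V n) :=
  {μ | ∃ c : Fin n → ℤ, μ = ∑ i, (c i : ℝ) • coroot (D.simple i)}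

/-- The affine Weyl group `W`, as the group of permutations of `V` generated by all
affine reflections `s_{α,k}` with `α ∈ Φ`, `k ∈ ℤ`. -/
def AffW (D : RootData n) : Subgroup (Equiv.Perm (V n)) :=
  Subgroup.closure {e : Equiv.Perm (V n) | ∃ α ∈ D.Φ, ∃ k : ℤ, ⇑e = sRefl α (k : ℝ)}

/-- The finite Weyl group `W₀`, generated by the linear reflections `s_{α,0}`. -/
def FinW (D : RootData n) : Subgroup (Equiv.Perm (V n)) :=
  Subgroup.closure {e : Equiv.Perm (V n) | ∃ α ∈ D.Φ, ⇑e = sRefl α 0}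

/-- The Coxeter generating set `S = {s₀, s₁, …, sₙ}` of the affine Weyl group. -/
def SGen (D : RootData n) : Set (AffW D) :=
  {s | ⇑(s : Equiv.Perm (V n)) = sRefl D.highest 1 ∨
       ∃ i : Fin n, ⇑(s : Equiv.Perm (V n)) = sRefl (D.simple i) 0}

/-- The Coxeter length of `y ∈ W` with respect to `S`. -/
def lenW (D : RootData n) (y : AffW D) : ℕ :=
  sInf {m | ∃ l : List (AffW D), (∀ s ∈ l, s ∈ SGen D) ∧ l.length = m ∧ l.prod = y}

/-- The fundamental alcove `𝐚_f`. -/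
def fund (D : RootData n) : Set (V n) :=
  {v | (∀ i, 0 ≤ ⟪D.simple i, v⟫) ∧ ⟪D.highest, v⟫ ≤ 1}

/-- The union of all the hyperplanes `H_{α,k}`. -/
def wallUnion (D : RootData n) : Set (V n) := ⋃ α ∈ D.Φ, ⋃ k : ℤ, Hy α (k : ℝ)

/-- An alcove: the closure of a connected component of the complement of all walls. -/
def IsAlcove (D : RootData n) (c : Set (V n)) : Prop :=
  ∃ v ∈ (wallUnion D)ᶜ, c = closure (connectedComponentIn (wallUnion D)ᶜ v)

/-- A (closed) face of the Coxeter complex: the closure of an equivalence class of points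
having the same position relative to every hyperplane of the arrangement. -/
def IsFace (D : RootData n) (F : Set (V n)) : Prop :=
  ∃ v : V n, F = closure {w | ∀ α ∈ D.Φ, ∀ k : ℤ,
    (⟪α, w⟫ = (k : ℝ) ↔ ⟪α, v⟫ = (k : ℝ)) ∧ (⟪α, w⟫ < (k : ℝ) ↔ ⟪α, v⟫ < (k : ℝ))}

/-- The set of all hyperplanes of the affine arrangement, as subsets of `V`. -/
def hyperplanes (D : RootData n) : Set (Set (V n)) :=
  {H | ∃ α ∈ D.Φ, ∃ k : ℤ, H = Hy α (k : ℝ)}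

/-- `p` is a panel (codimension-one face) of the alcove `c`: it is the intersection of `c`
with a wall, and it lies in exactly one hyperplane (its supporting hyperplane). -/
def IsPanelOf (D : RootData n) (p c : Set (V n)) : Prop :=
  IsAlcove D c ∧ IsFace D p ∧ (∃ H ∈ hyperplanes D, p = c ∩ H) ∧
    ∃! H, H ∈ hyperplanes D ∧ p ⊆ H

/-- The action of an element of the affine Weyl group on subsets of `V`. -/
def actW {D : RootData n} (x : AffW D) (A : Set (V n)) : Set (V n) :=
  ⇑(x : Equiv.Perm (V n)) '' A

/-- The data of a finite combinatorial gallery `(p₀, c₀, p₁, …, p_l, c_l, p_{l+1})`: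
`len = l`, alcoves `c 0, …, c len` and faces `p 0, …, p (len+1)`. -/
structure PreGallery (n : ℕ) where
  len : ℕ
  p : ℕ → Set (V n)
  c : ℕ → Set (V n)

/-- The gallery conditions for the data of a combinatorial gallery. -/
def IsGallery (D : RootData n) (γ : PreGallery n) : Prop :=
  (∀ i ≤ γ.len, IsAlcove D (γ.c i)) ∧
  (IsFace D (γ.p 0) ∧ γ.p 0 ⊆ γ.c 0) ∧
  (IsFace D (γ.p (γ.len + 1)) ∧ γ.p (γ.len + 1) ⊆ γ.c γ.len) ∧
  ∀ i, 1 ≤ i → i ≤ γ.len → IsPanelOf D (γ.p i) (γ.c (i - 1)) ∧ IsPanelOf D (γ.p i) (γ.c i)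

/-- A gallery is positively folded with respect to an orientation `φ` if whenever it has a
fold at `pᵢ` (i.e. `c_{i-1} = c_i`), `φ(cᵢ, pᵢ) = +`. -/
def PositivelyFolded (φ : Set (V n) → Set (V n) → Prop) (γ : PreGallery n) : Prop :=
  ∀ i, 1 ≤ i → i ≤ γ.len → γ.c (i - 1) = γ.c i → φ (γ.c i) (γ.p i)

/-- `X` and `Y` lie in a common closed half-space bounded by `H_{α,k}`. -/
def sameSide (α : V n) (k : ℝ) (X Y : Set (V n)) : Prop :=
  (X ⊆ Hge α k ∧ Y ⊆ Hge α k) ∨ (X ⊆ Hle α k ∧ Y ⊆ Hle α k)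

/-- The hyperplane `H_{α,k}` separates `X` from `Y` (they lie in opposite closed
half-spaces). -/
def Separates (α : V n) (k : ℝ) (X Y : Set (V n)) : Prop :=
  (X ⊆ Hge α k ∧ Y ⊆ Hle α k) ∨ (X ⊆ Hle α k ∧ Y ⊆ Hge α k)

/-- The orientation induced by an alcove `A`: `φ(c,p) = +` iff the closed half-space bounded
by the supporting hyperplane of `p` which contains `c` does not contain `A`. -/
def alcoveOrient (D : RootData n) (A : Set (V n)) : Set (V n) → Set (V n) → Prop :=
  fun c p => ∀ α ∈ D.Φ, ∀ k : ℤ, p ⊆ Hy α (k : ℝ) → ¬ sameSide α (k : ℝ) c A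

/-- Two faces have the same type iff they lie in the same orbit of the affine Weyl group. -/
def SameTypeFace (D : RootData n) (σ σ' : Set (V n)) : Prop :=
  ∃ x : Equiv.Perm (V n), x ∈ AffW D ∧ σ' = ⇑x '' σ

/-- Two galleries have the same type iff they have the same length and corresponding
faces (first face, panels, last face) have the same types. -/
def SameTypeGallery (D : RootData n) (γ γ' : PreGallery n) : Prop :=
  γ.len = γ'.len ∧ ∀ i ≤ γ.len + 1, SameTypeFace D (γ.p i) (γ'.p i)

/-- A gallery is minimal if it has minimal length among all galleries with the same first
and last faces. -/
def IsMinimal (D : RootData n) (γ : PreGallery n) : Prop :=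
  IsGallery D γ ∧ ∀ γ' : PreGallery n, IsGallery D γ' → γ'.p 0 = γ.p 0 →
    γ'.p (γ'.len + 1) = γ.p (γ.len + 1) → γ.len ≤ γ'.len

/-- The shadow with respect to the orientation `φ`, relative to a fixed (minimal) gallery
`γ`: the set of final simplices of all galleries of the same type as `γ`, with the same
first face, which are positively folded with respect to `φ`. -/
def Shadow (D : RootData n) (φ : Set (V n) → Set (V n) → Prop) (γ : PreGallery n) :
    Set (Set (V n)) :=
  {ζ | ∃ γ' : PreGallery n, IsGallery D γ' ∧ SameTypeGallery D γ γ' ∧ γ'.p 0 = γ.p 0 ∧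
    PositivelyFolded φ γ' ∧ ζ = γ'.p (γ'.len + 1)}

/-- The vertex version of the shadow: the set of points `μ` whose corresponding vertex
(the singleton face `{μ}`) is a final simplex of a positively folded gallery of the
appropriate type. -/
def VShadow (D : RootData n) (φ : Set (V n) → Set (V n) → Prop) (γ : PreGallery n) :
    Set (V n) :=
  {μ | ({μ} : Set (V n)) ∈ Shadow D φ γ}

/-- The orbit `W₀ · λ` of a point under the finite Weyl group. -/
def W0orbit (D : RootData n) (lam : V n) : Set (V n) :=
  {v | ∃ w ∈ FinW D, v = w lam}

/-- The closed half-space bounded by `H_{α,k}` which contains the fundamental alcove. -/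
def HalfId (D : RootData n) (α : V n) (k : ℝ) : Set (V n) :=
  if fund D ⊆ Hge α k then Hge α k else Hle α k

/-- `[j,m]` is a (finite) `H_{α,k}`-protrusion of `γ`. -/
def IsProtrusionFin (D : RootData n) (γ : PreGallery n) (α : V n) (k : ℝ) (j m : ℕ) : Prop :=
  j < m ∧ m ≤ γ.len + 1 ∧ γ.p j ⊆ Hy α k ∧ γ.p m ⊆ Hy α k ∧
    ∀ i, j ≤ i → i < m → ¬ γ.c i ⊆ HalfId D α k

/-- `[j,∞)` is an (infinite) `H_{α,k}`-protrusion of `γ`. -/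
def IsProtrusionInf (D : RootData n) (γ : PreGallery n) (α : V n) (k : ℝ) (j : ℕ) : Prop :=
  j ≤ γ.len + 1 ∧ γ.p j ⊆ Hy α k ∧ ∀ i, j ≤ i → i ≤ γ.len → ¬ γ.c i ⊆ HalfId D α k

/-- The set of indices reflected by the maximal `H`-outcrop: the union of (the index sets
of) all `H`-protrusions. -/
def maxOutcrop (D : RootData n) (γ : PreGallery n) (α : V n) (k : ℝ) : Set ℕ :=
  {i | (∃ j m, IsProtrusionFin D γ α k j m ∧ j ≤ i ∧ i < m) ∨
       (∃ j, IsProtrusionInf D γ α k j ∧ j ≤ i)}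

/-- `[j,m]` is a (finite) `H_{α,k}`-indentation of `γ`. -/
def IsIndentationFin (D : RootData n) (γ : PreGallery n) (α : V n) (k : ℝ) (j m : ℕ) : Prop :=
  1 ≤ j ∧ j < m ∧ m ≤ γ.len + 1 ∧ γ.p j ⊆ Hy α k ∧ γ.p m ⊆ Hy α k ∧
    ∀ i, j ≤ i → i < m → γ.c i ⊆ HalfId D α k

/-- `[j,∞)` is an (infinite) `H_{α,k}`-indentation of `γ`. -/
def IsIndentationInf (D : RootData n) (γ : PreGallery n) (α : V n) (k : ℝ) (j : ℕ) : Prop :=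
  1 ≤ j ∧ j ≤ γ.len + 1 ∧ γ.p j ⊆ Hy α k ∧ ∀ i, j ≤ i → i ≤ γ.len → γ.c i ⊆ HalfId D α k

/-- The set of indices reflected by the maximal `H`-ingrowth: the union of (the index sets
of) all `H`-indentations. -/
def maxIngrowth (D : RootData n) (γ : PreGallery n) (α : V n) (k : ℝ) : Set ℕ :=
  {i | (∃ j m, IsIndentationFin D γ α k j m ∧ j ≤ i ∧ i < m) ∨
       (∃ j, IsIndentationInf D γ α k j ∧ j ≤ i)}

/-- The operators `e_H^L` and `f_H^L`: reflect in `H_{α,k}` those alcoves (and the faces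
in between) whose indices belong to `L`.  (Since the bounding faces of a protrusion or
indentation lie in `H`, they are fixed pointwise by the reflection, so this uniform
description agrees with the usual one.) -/
def flipGallery (α : V n) (k : ℝ) (L : Set ℕ) (γ : PreGallery n) : PreGallery n :=
  ⟨γ.len,
   fun i => if i ∈ L then sRefl α k '' γ.p i else γ.p i,
   fun i => if i ∈ L then sRefl α k '' γ.c i else γ.c i⟩

/-- `P` is the index set of a single `H`-protrusion. -/
def IsFlipProtrusion (D : RootData n) (γ : PreGallery n) (α : V n) (k : ℝ) (P : Set ℕ) :
    Prop :=
  (∃ j m, IsProtrusionFin D γ α k j m ∧ P = Set.Ico j m) ∨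
  (∃ j, IsProtrusionInf D γ α k j ∧ P = Set.Ici j)

/-- `P` is the index set of a single `H`-indentation. -/
def IsFlipIndentation (D : RootData n) (γ : PreGallery n) (α : V n) (k : ℝ) (P : Set ℕ) :
    Prop :=
  (∃ j m, IsIndentationFin D γ α k j m ∧ P = Set.Ico j m) ∨
  (∃ j, IsIndentationInf D γ α k j ∧ P = Set.Ici j)

/-- `L` is an `H`-outcrop: a disjoint union of `H`-protrusions. -/
def IsOutcrop (D : RootData n) (γ : PreGallery n) (α : V n) (k : ℝ) (L : Set ℕ) : Prop :=
  ∃ C : Set (Set ℕ), (∀ P ∈ C, IsFlipProtrusion D γ α k P) ∧ C.Pairwise Disjoint ∧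
    L = ⋃₀ C

/-- `L` is an `H`-ingrowth: a disjoint union of `H`-indentations. -/
def IsIngrowth (D : RootData n) (γ : PreGallery n) (α : V n) (k : ℝ) (L : Set ℕ) : Prop :=
  ∃ C : Set (Set ℕ), (∀ P ∈ C, IsFlipIndentation D γ α k P) ∧ C.Pairwise Disjoint ∧
    L = ⋃₀ C

/-- The dominant Weyl chamber `C_f`. -/
def Cf (D : RootData n) : Set (V n) := {v | ∀ α ∈ D.pos, 0 ≤ ⟪α, v⟫}

/-- The closed half-space `α^{k,w}` bounded by `H_{α,k}` which contains a subsector of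
the Weyl chamber `w·C_f`. -/
def halfFor (D : RootData n) (α : V n) (k : ℝ) (w : Equiv.Perm (V n)) : Set (V n) :=
  if ∀ v ∈ Cf D, 0 ≤ ⟪α, w v⟫ then Hge α k else Hle α k

/-- The sub-root system `Φ_J` spanned by the simple roots indexed by `J`. -/
def PhiJ (D : RootData n) (J : Set (Fin n)) : Set (V n) :=
  {α | α ∈ D.Φ ∧ α ∈ Submodule.span ℝ (D.simple '' J)}

/-- The positive roots `Φ_J⁺` of the sub-root system `Φ_J`. -/
def PhiJpos (D : RootData n) (J : Set (Fin n)) : Set (V n) := D.pos ∩ PhiJ D J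

/-- `w0` is the longest element of the finite Weyl group: it maps the dominant Weyl chamber
to the antidominant one. -/
def IsLongest (D : RootData n) (w0 : Equiv.Perm (V n)) : Prop :=
  w0 ∈ FinW D ∧ ⇑w0 '' Cf D = {v | -v ∈ Cf D}

/-- The `J`-chimney `ξ_J`, a collection of closed half-spaces. -/
def chimney (D : RootData n) (J : Set (Fin n)) (w0 : Equiv.Perm (V n)) : Set (Set (V n)) :=
  {h | ∃ α ∈ PhiJpos D J, ∃ k : ℤ, k ≤ 0 ∧ h = halfFor D α (k : ℝ) 1} ∪
  {h | ∃ α ∈ PhiJpos D J, ∃ k : ℤ, 1 ≤ k ∧ h = halfFor D α (k : ℝ) w0} ∪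
  {h | ∃ β ∈ D.pos \ PhiJpos D J, ∃ k : ℤ, h = halfFor D β (k : ℝ) w0}

/-- The `(J,y)`-chimney `ξ_{J,y} = y · ξ_J`. -/
def chimneyY (D : RootData n) (J : Set (Fin n)) (w0 : Equiv.Perm (V n)) (y : AffW D) :
    Set (Set (V n)) :=
  {h | ∃ h' ∈ chimney D J w0, h = actW y h'}

/-- The orientation `φ_{J,y}` induced by the `(J,y)`-chimney: `φ(c,p) = +` iff the closed
half-space bounded by the supporting hyperplane of `p` which contains `c` is not an
element of `ξ_{J,y}`. -/
def chimneyOrient (D : RootData n) (J : Set (Fin n)) (w0 : Equiv.Perm (V n)) (y : AffW D) :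
    Set (V n) → Set (V n) → Prop :=
  fun c p => ∀ α ∈ D.Φ, ∀ k : ℤ, p ⊆ Hy α (k : ℝ) →
    ¬ ((c ⊆ Hge α (k : ℝ) ∧ Hge α (k : ℝ) ∈ chimneyY D J w0 y) ∨
       (c ⊆ Hle α (k : ℝ) ∧ Hle α (k : ℝ) ∈ chimneyY D J w0 y))

/-- The `J`-sector determined by integers `n_β`, `β ∈ Φ⁺ ∖ Φ_J⁺`. -/
def sectorJ (D : RootData n) (J : Set (Fin n)) (w0 : Equiv.Perm (V n)) (nb : V n → ℤ) :
    Set (V n) :=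
  (⋂ α ∈ PhiJpos D J, halfFor D α 0 1 ∩ halfFor D α 1 w0) ∩
  ⋂ β ∈ D.pos \ PhiJpos D J, halfFor D β (nb β : ℝ) w0

/-- The `(J,y)`-sector `y · S_J({n_β})`. -/
def sectorJY (D : RootData n) (J : Set (Fin n)) (w0 : Equiv.Perm (V n)) (y : AffW D)
    (nb : V n → ℤ) : Set (V n) :=
  actW y (sectorJ D J w0 nb)

/-- The data of an infinite combinatorial gallery `(p₀, c₀, p₁, c₁, …)`. -/
structure InfPreGallery (n : ℕ) where
  p : ℕ → Set (V n)
  c : ℕ → Set (V n)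

/-- The gallery conditions for an infinite combinatorial gallery. -/
def IsInfGallery (D : RootData n) (Γ : InfPreGallery n) : Prop :=
  (∀ i, IsAlcove D (Γ.c i)) ∧ IsFace D (Γ.p 0) ∧ Γ.p 0 ⊆ Γ.c 0 ∧
    ∀ i, 1 ≤ i → IsPanelOf D (Γ.p i) (Γ.c (i - 1)) ∧ IsPanelOf D (Γ.p i) (Γ.c i)

/-- The initial finite subgallery `(p₀, c₀, …, p_{m+1})` of an infinite gallery. -/
def truncGallery (Γ : InfPreGallery n) (m : ℕ) : PreGallery n := ⟨m, Γ.p, Γ.c⟩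

/-- An infinite gallery is minimal if every initial finite subgallery is minimal. -/
def InfMinimal (D : RootData n) (Γ : InfPreGallery n) : Prop :=
  ∀ m : ℕ, IsMinimal D (truncGallery Γ m)

/-- Regularity of a (minimal infinite) gallery with respect to the `(J,y)`-sector, where
`y = t^μ u`. -/
def RegularWrt (D : RootData n) (J : Set (Fin n)) (w0 u : Equiv.Perm (V n)) (μ : V n)
    (nb : V n → ℤ) (Γ : InfPreGallery n) : Prop :=
  ∀ β ∈ D.pos \ PhiJpos D J, ∀ k : ℤ,
    halfFor D (u β) (k : ℝ) (u * w0) ⊆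
      halfFor D (u β) ((nb β : ℝ) + ⟪u β, μ⟫) (u * w0) →
    ∃ i, Γ.c i ⊆ halfFor D (u β) (k : ℝ) (u * w0)

/-- The panel of the fundamental alcove fixed by the generator `s ∈ S` (determining the
type of a panel). -/
def fixedPanelType {D : RootData n} (s : AffW D) : Set (V n) :=
  fund D ∩ {v | (s : Equiv.Perm (V n)) v = v}

/-- `γ` has type `(type(σ0), s_{j₁}, …, s_{j_l}, type(τ))` where the `s_{jᵢ}` are the
entries of the word `l`. -/
def HasWordType (D : RootData n) (γ : PreGallery n) (σ0 : Set (V n)) (l : List (AffW D))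
    (τ : Set (V n)) : Prop :=
  γ.len = l.length ∧ SameTypeFace D σ0 (γ.p 0) ∧ SameTypeFace D τ (γ.p (γ.len + 1)) ∧
    ∀ i, ∀ h : i < l.length, SameTypeFace D (fixedPanelType (l.get ⟨i, h⟩)) (γ.p (i + 1))

/-- `l` is a reduced word for `w ∈ W`. -/
def IsReducedWord (D : RootData n) (l : List (AffW D)) (w : AffW D) : Prop :=
  (∀ s ∈ l, s ∈ SGen D) ∧ l.prod = w ∧ l.length = lenW D w

end


namespace ShadowPf

/-- Affine function attached to a root and an integer. -/
noncomputable def vl {n : ℕ} (f : V n × ℤ) (v : V n) : ℝ := ⟪f.1, v⟫ - (f.2 : ℝ)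

noncomputable def rf {n : ℕ} (f : V n × ℤ) : V n → V n := sRefl f.1 (f.2 : ℝ)

lemma rf_apply {n : ℕ} (f : V n × ℤ) (v : V n) : rf f v = v - vl f v • coroot f.1 := rfl

lemma inner_coroot_self {n : ℕ} {a : V n} (h : a ≠ 0) : ⟪a, coroot a⟫ = 2 := by
  have : ⟪a, a⟫ ≠ 0 := inner_self_ne_zero.mpr h
  simp only [coroot, inner_smul_right]
  field_simp

lemma coroot_zero {n : ℕ} : coroot (0 : V n) = 0 := by simp [coroot]

lemma vl_sub_smul {n : ℕ} (f : V n × ℤ) (v w : V n) (c : ℝ) :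
    vl f (v - c • w) = vl f v - c * ⟪f.1, w⟫ := by
  simp only [vl, inner_sub_right, inner_smul_right]; ring

lemma vl_rf_self {n : ℕ} (f : V n × ℤ) (h : f.1 ≠ 0) (v : V n) : vl f (rf f v) = - vl f v := by
  rw [rf_apply, vl_sub_smul, inner_coroot_self h]; ring

lemma rf_invol {n : ℕ} (f : V n × ℤ) : Function.Involutive (rf f) := by
  intro v
  by_cases h : f.1 = 0
  · simp [rf_apply, h, coroot_zero]
  · rw [rf_apply f (rf f v), vl_rf_self f h, rf_apply]; simp

/-- The reflection as a permutation. -/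
noncomputable def sP {n : ℕ} (f : V n × ℤ) : Equiv.Perm (V n) := (rf_invol f).toPerm

lemma sP_apply {n : ℕ} (f : V n × ℤ) (v : V n) : sP f v = v - vl f v • coroot f.1 := rfl
lemma sP_coe {n : ℕ} (f : V n × ℤ) : ⇑(sP f) = sRefl f.1 (f.2 : ℝ) := rfl
lemma sP_sP {n : ℕ} (f : V n × ℤ) (v : V n) : sP f (sP f v) = v := rf_invol f v
lemma sP_mul_self {n : ℕ} (f : V n × ℤ) : sP f * sP f = 1 := by
  ext1 v; exact sP_sP f v
lemma sP_inv {n : ℕ} (f : V n × ℤ) : (sP f)⁻¹ = sP f := by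
  rw [inv_eq_iff_mul_eq_one, sP_mul_self]
lemma vl_sP_self {n : ℕ} (f : V n × ℤ) (h : f.1 ≠ 0) (v : V n) : vl f (sP f v) = - vl f v :=
  vl_rf_self f h v
lemma sP_fix {n : ℕ} {f : V n × ℤ} {v : V n} (h : vl f v = 0) : sP f v = v := by
  rw [sP_apply, h]; simp

def Rt {n : ℕ} (D : RootData n) (f : V n × ℤ) : Prop := f.1 ∈ D.Φ

lemma Rt.ne {n : ℕ} {D : RootData n} {f : V n × ℤ} (h : Rt D f) : f.1 ≠ 0 := D.nonzero _ h

def ng {n : ℕ} (f : V n × ℤ) : V n × ℤ := (-f.1, -f.2)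

lemma vl_ng {n : ℕ} (f : V n × ℤ) (v : V n) : vl (ng f) v = - vl f v := by
  simp [vl, ng]; ring
lemma Rt.ng {n : ℕ} {D : RootData n} {f : V n × ℤ} (h : Rt D f) : Rt D (ng f) := D.neg_mem _ h

lemma sP_ng {n : ℕ} (f : V n × ℤ) : sP (ng f) = sP f := by
  ext1 v
  rw [sP_apply, sP_apply, vl_ng]
  simp [ng, coroot]

lemma sP_mem {n : ℕ} {D : RootData n} {f : V n × ℤ} (h : Rt D f) : sP f ∈ AffW D :=
  Subgroup.subset_closure ⟨f.1, h, f.2, rfl⟩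

/-- Pull back of a wall function along a group element. -/
def Pl {n : ℕ} (g : Equiv.Perm (V n)) (f f' : V n × ℤ) : Prop :=
  (∀ v, vl f (g v) = vl f' v) ∧ sP f * g = g * sP f' ∧ ‖f'.1‖ = ‖f.1‖

lemma pl_refl {n : ℕ} {D : RootData n} {e f : V n × ℤ} (he : Rt D e) (hf : Rt D f) :
    ∃ f', Rt D f' ∧ Pl (sP e) f f' := by
  obtain ⟨m, hm⟩ := D.crystallographic _ he _ hf
  have h1 := D.reflect_mem _ he _ hf
  have e0 : ⟪e.1, e.1⟫ ≠ 0 := inner_self_ne_zero.mpr he.ne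
  rw [hm] at h1
  have hm' : 2 * ⟪e.1, f.1⟫ = m * ⟪e.1, e.1⟫ := by field_simp at hm; linarith
  have hval : ∀ v, vl f (sP e v) = vl (f.1 - (m : ℝ) • e.1, f.2 - e.2 * m) v := by
    intro v
    rw [sP_apply, vl_sub_smul]
    have : ⟪f.1, coroot e.1⟫ = m := by
      rw [coroot, inner_smul_right, real_inner_comm e.1 f.1, ← hm]; ring
    rw [this]
    simp only [vl, inner_sub_left, inner_smul_left]
    push_cast
    simp; ring
  have hin : ⟪f.1 - (m : ℝ) • e.1, f.1 - (m : ℝ) • e.1⟫ = ⟪f.1, f.1⟫ := by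
    simp only [inner_sub_left, inner_sub_right, inner_smul_left, inner_smul_right]
    rw [real_inner_comm e.1 f.1]
    simp only [conj_trivial]
    linear_combination (-(m : ℝ)) * hm'
  refine ⟨(f.1 - (m : ℝ) • e.1, f.2 - e.2 * m), h1, hval, ?_, ?_⟩
  · ext1 v
    rw [Equiv.Perm.mul_apply, Equiv.Perm.mul_apply, sP_apply f, hval v,
      sP_apply (f.1 - (m : ℝ) • e.1, f.2 - e.2 * m)]
    generalize vl (f.1 - (m : ℝ) • e.1, f.2 - e.2 * m) v = a
    rw [sP_apply, sP_apply, vl_sub_smul]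
    have h2 : ⟪e.1, coroot (f.1 - (m : ℝ) • e.1)⟫ = - (2 / ⟪f.1, f.1⟫) * (⟪e.1, f.1⟫) := by
      rw [coroot, hin]
      simp only [inner_sub_right, inner_smul_right]
      linear_combination (2 / ⟪f.1, f.1⟫) * hm'
    rw [h2]
    simp only [coroot, hin]
    match_scalars
    · simp
    · field_simp
      linear_combination a * ⟪f.1, f.1⟫⁻¹ * hm'
    · ring
  · rw [norm_eq_sqrt_real_inner, norm_eq_sqrt_real_inner, hin]

lemma words {n : ℕ} (P : V n × ℤ → Prop) {S : Set (Equiv.Perm (V n))}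
    (hS : ∀ x ∈ S, ∃ f, P f ∧ x = sP f) {g : Equiv.Perm (V n)} (hg : g ∈ Subgroup.closure S) :
    ∃ l : List (V n × ℤ), (∀ f ∈ l, P f) ∧ g = (l.map sP).prod := by
  induction hg using Subgroup.closure_induction_left with
  | one => exact ⟨[], by simp, by simp⟩
  | mul_left x hx y hy ih =>
    obtain ⟨l, hl, rfl⟩ := ih
    obtain ⟨f, hf, rfl⟩ := hS x hx
    exact ⟨f :: l, by simpa using ⟨hf, fun a b => hl (a, b)⟩, by simp⟩
  | inv_mul_cancel x hx y hy ih =>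
    obtain ⟨l, hl, rfl⟩ := ih
    obtain ⟨f, hf, rfl⟩ := hS x hx
    exact ⟨f :: l, by simpa using ⟨hf, fun a b => hl (a, b)⟩, by simp [sP_inv]⟩

lemma pl_mem {n : ℕ} {D : RootData n} {g : Equiv.Perm (V n)} (hg : g ∈ AffW D) :
    ∀ f, Rt D f → ∃ f', Rt D f' ∧ Pl g f f' := by
  have key : ∀ x ∈ {e : Equiv.Perm (V n) | ∃ α ∈ D.Φ, ∃ k : ℤ, ⇑e = sRefl α (k : ℝ)},
      ∃ e, Rt D e ∧ x = sP e := by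
    rintro x ⟨a, ha, k, h⟩
    exact ⟨(a, k), ha, by ext1 v; rw [h]; rfl⟩
  have hmul : ∀ x y : Equiv.Perm (V n), (∀ f, Rt D f → ∃ f', Rt D f' ∧ Pl x f f') →
      (∀ f, Rt D f → ∃ f', Rt D f' ∧ Pl y f f') →
      (∀ f, Rt D f → ∃ f', Rt D f' ∧ Pl (x * y) f f') := by
    intro x y hx hy f hf
    obtain ⟨f1, h1, a1, b1, c1⟩ := hx f hf
    obtain ⟨f2, h2, a2, b2, c2⟩ := hy f1 h1
    refine ⟨f2, h2, fun v => by rw [Equiv.Perm.mul_apply, a1, a2], ?_, c2.trans c1⟩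
    rw [← mul_assoc, b1, mul_assoc, b2, mul_assoc]
  obtain ⟨l, hl, rfl⟩ := words (fun f => Rt D f) (S := {e : Equiv.Perm (V n) | ∃ α ∈ D.Φ, ∃ k : ℤ, ⇑e = sRefl α (k : ℝ)}) key hg
  clear hg
  induction l with
  | nil => exact fun f hf => ⟨f, hf, by simp [Pl]⟩
  | cons a l ih =>
    rw [List.map_cons, List.prod_cons]
    exact hmul _ _ (fun f hf => pl_refl (hl a List.mem_cons_self) hf)
      (ih fun y hy => hl y (List.mem_cons_of_mem _ hy))

def Gen {n : ℕ} (D : RootData n) (x : V n) : Prop := ∀ f, Rt D f → vl f x ≠ 0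

def Cl {n : ℕ} (D : RootData n) (x : V n) : Set (V n) := {q | ∀ f, Rt D f → 0 < vl f x → 0 ≤ vl f q}

def Sm {n : ℕ} (D : RootData n) (x y : V n) : Prop := ∀ f, Rt D f → 0 < vl f x → 0 < vl f y

lemma Sm.neg {n : ℕ} {D : RootData n} {x y : V n} (h : Sm D x y) {f} (hf : Rt D f)
    (hx : vl f x < 0) : vl f y < 0 := by
  have := h _ hf.ng (by rw [vl_ng]; linarith)
  rw [vl_ng] at this; linarith

lemma Sm.symm {n : ℕ} {D : RootData n} {x y : V n} (h : Sm D x y) (hx : Gen D x) : Sm D y x := by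
  intro f hf hy
  by_contra hc
  have := h.neg hf (lt_of_le_of_ne (not_lt.mp hc) (hx f hf))
  linarith

lemma Sm.trans {n : ℕ} {D : RootData n} {x y z : V n} (h : Sm D x y) (h' : Sm D y z) : Sm D x z :=
  fun f hf hx => h' f hf (h f hf hx)

lemma mem_Cl_self {n : ℕ} {D : RootData n} (x : V n) : x ∈ Cl D x := fun _ _ h => h.le

lemma Cl_neg {n : ℕ} {D : RootData n} {x q : V n} (h : q ∈ Cl D x) {f} (hf : Rt D f)
    (hx : vl f x < 0) : vl f q ≤ 0 := by
  have := h _ hf.ng (by rw [vl_ng]; linarith)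
  rw [vl_ng] at this; linarith

lemma Cl_eq_of_Sm {n : ℕ} {D : RootData n} {x y : V n} (hx : Gen D x) (h : Sm D x y) :
    Cl D x = Cl D y := by
  ext q
  exact ⟨fun hq f hf hy => hq f hf (h.symm hx f hf hy), fun hq f hf hy => hq f hf (h f hf hy)⟩

lemma Sm_of_mem {n : ℕ} {D : RootData n} {x y : V n} (hy : Gen D y) (h : y ∈ Cl D x) : Sm D x y :=
  fun f hf hx => lt_of_le_of_ne (h f hf hx) (hy f hf).symm

lemma Sm_of_Cl_eq {n : ℕ} {D : RootData n} {x y : V n} (hy : Gen D y) (h : Cl D x = Cl D y) :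
    Sm D x y := Sm_of_mem hy (h ▸ mem_Cl_self y)

lemma Gen.map {n : ℕ} {D : RootData n} {x : V n} (hx : Gen D x) {g} (hg : g ∈ AffW D) :
    Gen D (g x) := by
  intro f hf
  obtain ⟨f', h', a, -⟩ := pl_mem hg f hf
  rw [a]; exact hx f' h'

lemma Sm.map {n : ℕ} {D : RootData n} {x y : V n} (h : Sm D x y) {g} (hg : g ∈ AffW D) :
    Sm D (g x) (g y) := by
  intro f hf
  obtain ⟨f', h', a, -⟩ := pl_mem hg f hf
  rw [a, a]; exact h f' h'

lemma Cl_map {n : ℕ} {D : RootData n} {x q : V n} (h : q ∈ Cl D x) {g} (hg : g ∈ AffW D) :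
    g q ∈ Cl D (g x) := by
  intro f hf
  obtain ⟨f', h', a, -⟩ := pl_mem hg f hf
  rw [a, a]; exact h f' h'

lemma Cl_image {n : ℕ} {D : RootData n} (x : V n) {g} (hg : g ∈ AffW D) :
    g '' Cl D x = Cl D (g x) := by
  ext q
  constructor
  · rintro ⟨r, hr, rfl⟩; exact Cl_map hr hg
  · intro h
    refine ⟨g⁻¹ q, ?_, by simp⟩
    have := Cl_map h (inv_mem hg)
    simpa using this

lemma continuous_vl {n : ℕ} (f : V n × ℤ) : Continuous (vl f) := by
  unfold vl; fun_prop

lemma vl_comb {n : ℕ} (f : V n × ℤ) (a b : ℝ) (hab : a + b = 1) (x y : V n) :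
    vl f (a • x + b • y) = a * vl f x + b * vl f y := by
  simp only [vl, inner_add_right, inner_smul_right]
  linear_combination (f.2 : ℝ) * hab

lemma alcove_iff {n : ℕ} {D : RootData n} {c : Set (V n)} :
    IsAlcove D c ↔ ∃ x, Gen D x ∧ c = Cl D x := by
  have hmem : ∀ x, x ∈ (wallUnion D)ᶜ ↔ Gen D x := by
    intro x
    simp only [wallUnion, Set.mem_compl_iff, Set.mem_iUnion, not_exists, Gen, Rt, Hy,
      Set.mem_ofPred_eq, Prod.forall, vl, sub_ne_zero]
    exact ⟨fun h a k ha => h a ha k, fun h a ha k => h a k ha⟩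
  have hcl : ∀ x, Gen D x → closure (connectedComponentIn (wallUnion D)ᶜ x) = Cl D x := by
    intro x hx
    have hxm := (hmem x).2 hx
    have hcomp : connectedComponentIn (wallUnion D)ᶜ x = {y | Sm D x y} := by
      apply Set.Subset.antisymm
      · intro y hy f hf hfx
        by_contra hc
        have hpc := isPreconnected_connectedComponentIn (F := (wallUnion D)ᶜ) (x := x)
        have hi := hpc.intermediate_value hy (mem_connectedComponentIn hxm)
          (continuous_vl f).continuousOn
        obtain ⟨z, hz, hz0⟩ := hi ⟨not_lt.mp hc, hfx.le⟩
        exact (hmem z).1 (connectedComponentIn_subset _ _ hz) f hf hz0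
      · have hgen : ∀ y, Sm D x y → Gen D y := by
          intro y hy f hf
          rcases lt_or_gt_of_ne (hx f hf) with h | h
          · exact (hy.neg hf h).ne
          · exact (hy f hf h).ne'
        apply IsPreconnected.subset_connectedComponentIn
        · apply Convex.isPreconnected
          intro y hy z hz a b ha hb hab f hf hfx
          rw [vl_comb f a b hab]
          have h1 := hy f hf hfx
          have h2 := hz f hf hfx
          rcases ha.eq_or_lt with h | h
          · have : b = 1 := by linarith
            subst this; simp [← h, h2]
          · have := mul_pos h h1; have := mul_nonneg hb h2.le; linarith
        · exact fun f hf h => h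
        · exact fun y hy => (hmem y).2 (hgen y hy)
    rw [hcomp]
    apply Set.Subset.antisymm
    · apply closure_minimal
      · exact fun y hy f hf h => (hy f hf h).le
      · have : Cl D x = ⋂ f, ⋂ (_ : Rt D f), ⋂ (_ : 0 < vl f x), {q | 0 ≤ vl f q} := by
          ext q; simp [Cl]
        rw [this]
        refine isClosed_iInter fun f => isClosed_iInter fun _ => isClosed_iInter fun _ =>
          isClosed_le continuous_const (continuous_vl f)
    · intro q hq
      have ht : Filter.Tendsto (fun t : ℝ => (1 - t) • q + t • x) (nhdsWithin 0 (Set.Ioi 0))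
          (nhds q) := by
        have : Continuous (fun t : ℝ => (1 - t) • q + t • x) := by fun_prop
        have h := this.tendsto 0
        simp only [sub_zero, one_smul, zero_smul, add_zero] at h
        exact h.mono_left nhdsWithin_le_nhds
      refine mem_closure_of_tendsto ht ?_
      filter_upwards [Ioo_mem_nhdsGT (show (0 : ℝ) < 1 by norm_num)] with t ht f hf hfx
      rw [vl_comb f _ _ (by ring)]
      have h1 := hq f hf hfx
      have := mul_pos ht.1 hfx
      have := mul_nonneg (sub_nonneg.mpr ht.2.le) h1
      linarith
  constructor
  · rintro ⟨x, hx, rfl⟩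
    exact ⟨x, (hmem x).1 hx, hcl x ((hmem x).1 hx)⟩
  · rintro ⟨x, hx, rfl⟩
    exact ⟨x, (hmem x).2 hx, (hcl x hx).symm⟩

end ShadowPf

namespace ShadowPf

lemma prop_pair {n : ℕ} {D : RootData n} {f h : V n × ℤ} (hf : Rt D f) (hh : Rt D h) (c : ℝ)
    (H : ∀ v, vl f v = c * vl h v) : f = h ∨ f = ng h := by
  have h0 : (f.2 : ℝ) = c * h.2 := by
    have := H 0
    simp [vl] at this
    exact this
  have h1 : f.1 = c • h.1 := by
    apply ext_inner_right ℝ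
    intro v
    have := H v
    simp only [vl] at this
    rw [inner_smul_left]; simp; linarith
  have hc := D.reduced _ hh c (h1 ▸ hf)
  rcases hc with rfl | rfl
  · left
    ext1
    · simpa using h1
    · have : (f.2 : ℝ) = h.2 := by simpa using h0
      exact_mod_cast this
  · right
    ext1
    · simpa [ng] using h1
    · have : (f.2 : ℝ) = -h.2 := by simpa using h0
      simp only [ng]
      exact_mod_cast this

lemma prop_sP {n : ℕ} {D : RootData n} {f h : V n × ℤ} (hf : Rt D f) (hh : Rt D h) (c : ℝ)
    (H : ∀ v, vl f v = c * vl h v) : sP f = sP h := by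
  rcases prop_pair hf hh c H with rfl | rfl
  · rfl
  · exact sP_ng _

/-- Oriented walls separating `b` from `u`. -/
def Sep {n : ℕ} (D : RootData n) (b u : V n) : Set (V n × ℤ) :=
  {f | Rt D f ∧ vl f b < 0 ∧ 0 < vl f u}

lemma Sep_finite {n : ℕ} (D : RootData n) (b u : V n) : (Sep D b u).Finite := by
  have : Sep D b u ⊆ ⋃ a ∈ D.Φ, (fun k : ℤ => (a, k)) '' (Set.Icc ⌊⟪a, b⟫⌋ ⌈⟪a, u⟫⌉) := by
    rintro ⟨a, k⟩ ⟨h, h1, h2⟩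
    simp only [Set.mem_iUnion]
    refine ⟨a, h, k, ?_, rfl⟩
    simp only [vl] at h1 h2
    constructor
    · have : (⌊⟪a, b⟫⌋ : ℝ) ≤ k := (Int.floor_le _).trans (by linarith)
      exact_mod_cast this
    · have : (k : ℝ) ≤ ⌈⟪a, u⟫⌉ := le_trans (by linarith) (Int.le_ceil _)
      exact_mod_cast this
  exact (D.finite.biUnion fun a _ => (Set.finite_Icc _ _).image _).subset this

/-- `f` bounds the alcove of `b`. -/
def Simp {n : ℕ} (D : RootData n) (b : V n) (f : V n × ℤ) : Prop :=
  Rt D f ∧ vl f b < 0 ∧ ∀ g, Rt D g → vl g b < 0 → 0 < vl g (sP f b) → g = f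

lemma exists_simp {n : ℕ} {D : RootData n} {b u : V n} (hne : (Sep D b u).Nonempty) :
    ∃ f, Simp D b f ∧ 0 < vl f u := by
  let τ : V n × ℤ → ℝ := fun f => - vl f b / (vl f u - vl f b)
  let d : V n × ℤ → ℝ := fun f => - vl f b / ‖f.1‖
  obtain ⟨f0, hf0, hmin0⟩ := Set.exists_min_image _ τ (Sep_finite D b u) hne
  obtain ⟨f, ⟨hfS, hfτ⟩, hmin⟩ := Set.exists_min_image {f | f ∈ Sep D b u ∧ τ f = τ f0} d
    ((Sep_finite D b u).subset fun f hf => hf.1) ⟨f0, hf0, rfl⟩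
  obtain ⟨hf, hfb, hfu⟩ := hfS
  refine ⟨f, ⟨hf, hfb, ?_⟩, hfu⟩
  intro g hg hgb hgs
  set T := τ f0 with hT
  have hTf : T * (vl f u - vl f b) = - vl f b := by
    rw [← hfτ]; simp only [τ]; rw [div_mul_cancel₀]; linarith
  have hT0 : 0 < T := by
    by_contra hc
    have := mul_nonneg (neg_nonneg.mpr (not_lt.mp hc)) (show 0 ≤ vl f u - vl f b by linarith)
    linarith
  have hT1 : T < 1 := by
    by_contra hc
    have := mul_nonneg (sub_nonneg.mpr (not_lt.mp hc)) (show 0 ≤ vl f u - vl f b by linarith)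
    linarith
  set z := (1 - T) • b + T • u with hz
  have hvz : ∀ e, vl e z = (1 - T) * vl e b + T * vl e u := fun e => vl_comb e _ _ (by ring) _ _
  have hle : ∀ e, Rt D e → vl e b < 0 → vl e z ≤ 0 := by
    intro e he heb
    rw [hvz]
    by_cases heu : 0 < vl e u
    · have h1 := hmin0 e ⟨he, heb, heu⟩
      have : T * (vl e u - vl e b) ≤ - vl e b := by
        have hp : 0 < vl e u - vl e b := by linarith
        calc T * (vl e u - vl e b) ≤ τ e * (vl e u - vl e b) :=
              mul_le_mul_of_nonneg_right h1 hp.le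
          _ = - vl e b := by simp only [τ]; rw [div_mul_cancel₀]; linarith
      linarith
    · nlinarith
  have hin : ∀ e, Rt D e → vl e b < 0 → vl e z = 0 → e ∈ Sep D b u ∧ τ e = T := by
    intro e he heb hez
    rw [hvz] at hez
    have h1 : T * (vl e u - vl e b) = - vl e b := by linarith
    have h2 : 0 < vl e u := by
      by_contra hc
      nlinarith
    refine ⟨⟨he, heb, h2⟩, ?_⟩
    simp only [τ]; rw [← h1, mul_div_cancel_right₀]; linarith
  have hfz : vl f z = 0 := by rw [hvz]; linarith
  obtain ⟨h', hh', hpl, -, hnorm⟩ := pl_mem (sP_mem hf) g hg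
  set h := ng h' with hh
  have hhR : Rt D h := hh'.ng
  have hhn : ‖h.1‖ = ‖g.1‖ := by rw [← hnorm]; simp [hh, ng]
  set m := ⟪g.1, coroot f.1⟫ with hm
  have hsum : ∀ v, vl h v = - vl g v + vl f v * m := by
    intro v
    rw [hh, vl_ng, ← hpl, sP_apply, vl_sub_smul]; ring
  have hhb : vl h b < 0 := by rw [hh, vl_ng, ← hpl]; linarith
  have hgz := hle g hg hgb
  have hhz := hle h hhR hhb
  have hzz := hsum z
  rw [hfz] at hzz
  have hgz0 : vl g z = 0 := by linarith
  have hhz0 : vl h z = 0 := by linarith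
  have dg := hmin g (hin g hg hgb hgz0)
  have dh := hmin h (hin h hhR hhb hhz0)
  have hbb := hsum b
  have pf : 0 < ‖f.1‖ := norm_pos_iff.mpr hf.ne
  have pg : 0 < ‖g.1‖ := norm_pos_iff.mpr hg.ne
  simp only [d, hhn] at dg dh
  rw [div_le_div_iff₀ pf pg] at dg dh
  have hmv : m * (‖f.1‖ * ‖f.1‖) = 2 * ⟪g.1, f.1⟫ := by
    rw [hm, coroot, inner_smul_right, real_inner_self_eq_norm_mul_norm]
    field_simp
  have hcs : ‖g.1‖ * ‖f.1‖ ≤ ⟪g.1, f.1⟫ := by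
    have h1 : 2 * (- vl f b) * ‖g.1‖ ≤ (- vl f b) * (m * ‖f.1‖) := by
      have : - vl f b * m = - vl g b - vl h b := by linarith
      nlinarith
    have h2 : 2 * ‖g.1‖ ≤ m * ‖f.1‖ := by
      have : (- vl f b) * (2 * ‖g.1‖) ≤ (- vl f b) * (m * ‖f.1‖) := by linarith
      exact le_of_mul_le_mul_left this (by linarith)
    nlinarith
  have heq : ⟪g.1, f.1⟫ = ‖g.1‖ * ‖f.1‖ := le_antisymm (real_inner_le_norm _ _) hcs
  rw [inner_eq_norm_mul_iff_real] at heq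
  have hge : g.1 = (‖g.1‖ / ‖f.1‖) • f.1 := by
    rw [div_eq_inv_mul, mul_smul, ← heq, smul_smul, inv_mul_cancel₀ pf.ne', one_smul]
  have h1 : ‖g.1‖ / ‖f.1‖ = 1 := by
    rcases D.reduced _ hf (‖g.1‖ / ‖f.1‖) (by rw [← hge]; exact hg) with h | h
    · exact h
    · have := div_pos pg pf; linarith
  rw [h1, one_smul] at hge
  ext1
  · exact hge
  · simp only [vl] at hgz0 hfz
    rw [hge] at hgz0
    have : (g.2 : ℝ) = f.2 := by linarith
    exact_mod_cast this

/-- Subgroup generated by the reflections in the walls of the alcove of `b`. -/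
def WB {n : ℕ} (D : RootData n) (b : V n) : Subgroup (Equiv.Perm (V n)) :=
  Subgroup.closure {x | ∃ f, Simp D b f ∧ x = sP f}

lemma simp_mem {n : ℕ} {D : RootData n} {b : V n} {f} (h : Simp D b f) : sP f ∈ WB D b :=
  Subgroup.subset_closure ⟨f, h, rfl⟩

lemma simp_sub {n : ℕ} {D : RootData n} {b : V n} (hb : Gen D b) {f g : V n × ℤ}
    (h : Simp D b f) (hg : Rt D g) (h1 : vl g b < 0) (h2 : g ≠ f) : vl g (sP f b) < 0 := by
  by_contra hc
  exact h2 (h.2.2 g hg h1 (lt_of_le_of_ne (not_lt.mp hc)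
    ((hb.map (sP_mem h.1)) g hg).symm))

lemma sep_swap {n : ℕ} {D : RootData n} (b u : V n) {s : V n × ℤ} (hs : Rt D s) :
    (Sep D b (sP s u)).ncard ≤ (Sep D (sP s b) u).ncard := by
  have hch : ∀ f : V n × ℤ, ∃ f', Rt D f → (Rt D f' ∧ Pl (sP s) f f') := by
    intro f
    by_cases hf : Rt D f
    · obtain ⟨f', h⟩ := pl_mem (sP_mem hs) f hf
      exact ⟨f', fun _ => h⟩
    · exact ⟨f, fun h => (hf h).elim⟩
  choose φ hφ using hch
  refine Set.ncard_le_ncard_of_injOn φ ?_ ?_ (Sep_finite _ _ _)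
  · rintro f ⟨hf, h1, h2⟩
    obtain ⟨hR, hp, -⟩ := hφ f hf
    refine ⟨hR, ?_, ?_⟩
    · rw [← hp, sP_sP]; exact h1
    · rw [← hp]; exact h2
  · rintro f ⟨hf, hfb, -⟩ g ⟨hg, hgb, -⟩ hfg
    have h1 := (hφ f hf).2.1
    have h2 := (hφ g hg).2.1
    have : ∀ v, vl f v = vl g v := fun v => by
      have a := h1 (sP s v)
      have b := h2 (sP s v)
      rw [sP_sP] at a b
      rw [a, b, hfg]
    rcases prop_pair hf hg 1 (fun v => by rw [this, one_mul]) with h | h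
    · exact h
    · have := this b
      rw [h, vl_ng] at this; linarith

lemma refl_mem_WB {n : ℕ} {D : RootData n} {b : V n} (hb : Gen D b) :
    ∀ (N : ℕ) (h : V n × ℤ), Rt D h → (Sep D b (sP h b)).ncard ≤ N → sP h ∈ WB D b := by
  intro N
  induction N with
  | zero =>
    intro h hh hN
    exfalso
    have h0 : Sep D b (sP h b) = ∅ := by
      rwa [Nat.le_zero, Set.ncard_eq_zero (Sep_finite _ _ _)] at hN
    rcases lt_or_gt_of_ne (hb h hh) with h1 | h1
    · have : h ∈ Sep D b (sP h b) := ⟨hh, h1, by rw [vl_sP_self _ hh.ne]; linarith⟩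
      rw [h0] at this; exact this
    · have : ng h ∈ Sep D b (sP h b) := ⟨hh.ng, by rw [vl_ng]; linarith, by
        rw [vl_ng, vl_sP_self _ hh.ne]; linarith⟩
      rw [h0] at this; exact this
  | succ N ih =>
    intro h hh hN
    have hne : (Sep D b (sP h b)).Nonempty := by
      rcases lt_or_gt_of_ne (hb h hh) with h1 | h1
      · exact ⟨h, hh, h1, by rw [vl_sP_self _ hh.ne]; linarith⟩
      · exact ⟨ng h, hh.ng, by rw [vl_ng]; linarith, by
          rw [vl_ng, vl_sP_self _ hh.ne]; linarith⟩
    obtain ⟨f, hf, hft⟩ := exists_simp hne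
    by_cases hst : sP f = sP h
    · rw [← hst]; exact simp_mem hf
    obtain ⟨h', hh', hp1, hp2, -⟩ := pl_mem (sP_mem hf.1) h hh
    have hconj : sP h' = sP f * (sP h * sP f) := by
      rw [hp2, ← mul_assoc, sP_mul_self, one_mul]
    have hcard : (Sep D b (sP h' b)).ncard ≤ N := by
      have e1 : sP h' b = sP f (sP h (sP f b)) := by rw [hconj]; rfl
      rw [e1]
      refine (sep_swap b _ hf.1).trans ?_
      have hsub : Sep D (sP f b) (sP h (sP f b)) ⊆ Sep D b (sP h b) \ {f} := by
        rintro g ⟨hg, hg1, hg2⟩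
        have hgf : g ≠ f := by
          rintro rfl
          rw [vl_sP_self _ hf.1.ne] at hg1
          linarith [hf.2.1]
        have hgb : vl g b < 0 := by
          by_contra hc
          have hgb : 0 < vl g b := lt_of_le_of_ne (not_lt.mp hc) (hb g hg).symm
          have h1 : ng g = f := hf.2.2 _ hg.ng (by rw [vl_ng]; linarith) (by rw [vl_ng]; linarith)
          obtain ⟨f', hf', hq, -⟩ := pl_mem (sP_mem hh) f hf.1
          have a1 : 0 < vl f' b := by rw [← hq]; exact hft
          have a2 : vl f' (sP f b) < 0 := by
            have : vl f (sP h (sP f b)) = - vl g (sP h (sP f b)) := by rw [← vl_ng, h1]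
            rw [← hq, this]; linarith
          have h2 : ng f' = f := hf.2.2 _ hf'.ng (by rw [vl_ng]; linarith) (by rw [vl_ng]; linarith)
          apply hst
          refine prop_sP hf.1 hh (⟪f.1, coroot h.1⟫ / 2) fun v => ?_
          have b1 := hq v
          have b2 : vl f v = - vl f' v := by rw [← vl_ng, h2]
          rw [sP_apply, vl_sub_smul] at b1
          linarith
        refine ⟨⟨hg, hgb, ?_⟩, hgf⟩
        by_contra hc
        have hc' : vl g (sP h b) < 0 := lt_of_le_of_ne (not_lt.mp hc) ((hb.map (sP_mem hh)) g hg)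
        obtain ⟨g', hg', hq, -⟩ := pl_mem (sP_mem hh) g hg
        have : g' = f := hf.2.2 g' hg' (by rw [← hq]; exact hc') (by rw [← hq]; exact hg2)
        have h3 := hq (sP h b)
        rw [sP_sP, this] at h3
        linarith
      have hfm : f ∈ Sep D b (sP h b) := ⟨hf.1, hf.2.1, hft⟩
      have := Set.ncard_le_ncard hsub ((Sep_finite D b (sP h b)).subset Set.sdiff_subset)
      rw [Set.ncard_sdiff_singleton_of_mem hfm] at this
      omega
    have := ih h' hh' hcard
    have e2 : sP h = sP f * (sP h' * sP f) := by
      rw [hconj, mul_assoc, mul_assoc, sP_mul_self, mul_one, ← mul_assoc, sP_mul_self, one_mul]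
    rw [e2]
    exact mul_mem (simp_mem hf) (mul_mem this (simp_mem hf))

lemma affW_le_WB {n : ℕ} {D : RootData n} {b : V n} (hb : Gen D b) : AffW D ≤ WB D b := by
  rw [AffW, Subgroup.closure_le]
  rintro x ⟨a, ha, k, h⟩
  have : x = sP (a, k) := by ext1 v; rw [h]; rfl
  rw [this]
  exact refl_mem_WB hb _ _ ha le_rfl

lemma words_mem {n : ℕ} {D : RootData n} {l : List (V n × ℤ)} (hl : ∀ f ∈ l, Rt D f) :
    (l.map sP).prod ∈ AffW D := by
  apply Subgroup.list_prod_mem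
  intro x hx
  rw [List.mem_map] at hx
  obtain ⟨f, hf, rfl⟩ := hx
  exact sP_mem (hl f hf)

lemma exch {n : ℕ} {D : RootData n} {b : V n} (hb : Gen D b) {f : V n × ℤ} (hf : Rt D f)
    (hfb : vl f b < 0) (l : List (V n × ℤ)) : (∀ e ∈ l, Simp D b e) →
    0 < vl f ((l.map sP).prod b) → ∃ l' : List (V n × ℤ), (∀ e ∈ l', Simp D b e) ∧
      l'.length < l.length ∧ sP f * (l.map sP).prod = (l'.map sP).prod := by
  induction l using List.reverseRecOn with
  | nil => intro _ h; simp at h; linarith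
  | append_singleton l e ih =>
    intro hl h
    have hl0 : ∀ e ∈ l, Simp D b e := fun x hx => hl x (by simp [hx])
    have he : Simp D b e := hl e (by simp)
    have hmem : (l.map sP).prod ∈ AffW D := words_mem fun x hx => (hl0 x hx).1
    simp only [List.map_append, List.map_cons, List.map_nil, List.prod_append, List.prod_cons,
      List.prod_nil, mul_one, List.length_append, List.length_singleton] at h ⊢
    by_cases hc : 0 < vl f ((l.map sP).prod b)
    · obtain ⟨l', h1, h2, h3⟩ := ih hl0 hc
      refine ⟨l' ++ [e], ?_, by simp; omega, ?_⟩
      · intro x hx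
        rw [List.mem_append, List.mem_singleton] at hx
        rcases hx with hx | rfl
        · exact h1 x hx
        · exact he
      · simp [← h3, mul_assoc]
    · have hc' : vl f ((l.map sP).prod b) < 0 :=
        lt_of_le_of_ne (not_lt.mp hc) ((hb.map hmem) f hf)
      obtain ⟨f', hf', hq, hq2, -⟩ := pl_mem hmem f hf
      have : f' = e := he.2.2 f' hf' (by rw [← hq]; exact hc') (by rw [← hq]; exact h)
      refine ⟨l, hl0, by omega, ?_⟩
      rw [← mul_assoc, hq2, this, mul_assoc, sP_mul_self, mul_one]

lemma fund_aux {n : ℕ} {D : RootData n} {b : V n} (hb : Gen D b) (N : ℕ) :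
    ∀ (l : List (V n × ℤ)), l.length ≤ N → (∀ e ∈ l, Simp D b e) → ∀ q ∈ Cl D b,
      (l.map sP).prod q ∈ Cl D b → (l.map sP).prod q = q := by
  induction N with
  | zero =>
    intro l hl _ q _ _
    have : l = [] := List.length_eq_zero_iff.mp (by omega)
    simp [this]
  | succ N ih =>
    intro l hl hs q hq hq'
    cases l with
    | nil => simp
    | cons f l =>
      simp only [List.length_cons] at hl
      have hf : Simp D b f := hs f (by simp)
      have hl0 : ∀ e ∈ l, Simp D b e := fun x hx => hs x (by simp [hx])
      have hmem : (l.map sP).prod ∈ AffW D := words_mem fun x hx => (hl0 x hx).1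
      rw [List.map_cons, List.prod_cons] at hq' ⊢
      have hmem' := mul_mem (sP_mem hf.1) hmem
      by_cases hc : 0 < vl f ((sP f * (l.map sP).prod) b)
      · have h1 : vl f ((sP f * (l.map sP).prod) q) ≤ 0 := Cl_neg hq' hf.1 hf.2.1
        have h2 := Cl_map hq hmem' f hf.1 hc
        have h3 : vl f ((sP f * (l.map sP).prod) q) = 0 := le_antisymm h1 h2
        have h4 := sP_fix h3
        have h5 : (sP f * (l.map sP).prod) q = (l.map sP).prod q := by
          rw [← h4, Equiv.Perm.mul_apply, sP_sP]
        rw [h5] at hq' ⊢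
        exact ih l (by omega) hl0 q hq hq'
      · have hc' : vl f ((sP f * (l.map sP).prod) b) < 0 :=
          lt_of_le_of_ne (not_lt.mp hc) ((hb.map hmem') f hf.1)
        have h1 : 0 < vl f ((l.map sP).prod b) := by
          rw [Equiv.Perm.mul_apply, vl_sP_self _ hf.1.ne] at hc'; linarith
        obtain ⟨l', h2, h3, h4⟩ := exch hb hf.1 hf.2.1 l hl0 h1
        rw [h4] at hq' ⊢
        exact ih l' (by omega) h2 q hq hq'

/-- A closed alcove is a strict fundamental domain. -/
lemma fund_dom {n : ℕ} {D : RootData n} {b : V n} (hb : Gen D b) {g : Equiv.Perm (V n)}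
    (hg : g ∈ AffW D) {q : V n} (hq : q ∈ Cl D b) (hgq : g q ∈ Cl D b) : g q = q := by
  obtain ⟨l, hl, rfl⟩ := words (Simp D b) (fun x hx => hx) (affW_le_WB hb hg)
  exact fund_aux hb _ l le_rfl hl q hq hgq

lemma trans_aux {n : ℕ} {D : RootData n} {b : V n} (hb : Gen D b) (N : ℕ) :
    ∀ x, Gen D x → (Sep D b x).ncard ≤ N → ∃ g ∈ AffW D, Sm D b (g x) := by
  induction N with
  | zero =>
    intro x hx hN
    refine ⟨1, one_mem _, ?_⟩
    have h0 : Sep D b x = ∅ := by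
      rwa [Nat.le_zero, Set.ncard_eq_zero (Sep_finite _ _ _)] at hN
    intro f hf hfb
    by_contra hc
    have hc' : vl f x < 0 := lt_of_le_of_ne (not_lt.mp hc) (hx f hf)
    have : ng f ∈ Sep D b x := ⟨hf.ng, by rw [vl_ng]; linarith, by rw [vl_ng]; linarith⟩
    rw [h0] at this; exact this
  | succ N ih =>
    intro x hx hN
    rcases (Sep D b x).eq_empty_or_nonempty with h0 | hne
    · exact ih x hx (by simp [h0])
    obtain ⟨f, hf, hfx⟩ := exists_simp hne
    have : (Sep D b (sP f x)).ncard ≤ N := by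
      refine (sep_swap b x hf.1).trans ?_
      have hsub : Sep D (sP f b) x ⊆ Sep D b x \ {f} := by
        rintro g ⟨hg, h1, h2⟩
        refine ⟨⟨hg, ?_, h2⟩, ?_⟩
        · by_contra hc
          have hgb : 0 < vl g b := lt_of_le_of_ne (not_lt.mp hc) (hb g hg).symm
          have h3 : ng g = f := hf.2.2 _ hg.ng (by rw [vl_ng]; linarith) (by rw [vl_ng]; linarith)
          rw [← h3, vl_ng] at hfx; linarith
        · rintro rfl
          rw [vl_sP_self _ hf.1.ne] at h1
          linarith [hf.2.1]
      have hfm : f ∈ Sep D b x := ⟨hf.1, hf.2.1, hfx⟩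
      have := Set.ncard_le_ncard hsub ((Sep_finite D b x).subset Set.sdiff_subset)
      rw [Set.ncard_sdiff_singleton_of_mem hfm] at this
      omega
    obtain ⟨g, hg, h⟩ := ih (sP f x) (hx.map (sP_mem hf.1)) this
    exact ⟨g * sP f, mul_mem hg (sP_mem hf.1), h⟩

end ShadowPf

namespace ShadowPf

lemma mem_Hy {n : ℕ} (f : V n × ℤ) (v : V n) : v ∈ Hy f.1 (f.2 : ℝ) ↔ vl f v = 0 := by
  simp [Hy, vl, sub_eq_zero]

lemma hy_eq {n : ℕ} {D : RootData n} {f g : V n × ℤ} (hf : Rt D f) (hg : Rt D g)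
    (h : Hy g.1 (g.2 : ℝ) = Hy f.1 (f.2 : ℝ)) : g = f ∨ g = ng f := by
  have h0 : ⟪f.1, f.1⟫ ≠ 0 := inner_self_ne_zero.mpr hf.ne
  refine prop_pair hg hf (⟪g.1, f.1⟫ / ⟪f.1, f.1⟫) fun v => ?_
  have h1 : v - (vl f v / ⟪f.1, f.1⟫) • f.1 ∈ Hy f.1 (f.2 : ℝ) := by
    rw [mem_Hy, vl_sub_smul]; field_simp; ring
  rw [← h, mem_Hy, vl_sub_smul] at h1
  have : vl g v = (vl f v / ⟪f.1, f.1⟫) * ⟪g.1, f.1⟫ := by linarith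
  rw [this]; ring

/-- `f` is the wall supporting `p`. -/
def PW {n : ℕ} (D : RootData n) (p : Set (V n)) (f : V n × ℤ) : Prop :=
  Rt D f ∧ (∀ q ∈ p, vl f q = 0) ∧ ∀ g, Rt D g → (∀ q ∈ p, vl g q = 0) → g = f ∨ g = ng f

lemma PW.ng {n : ℕ} {D : RootData n} {p : Set (V n)} {f} (h : PW D p f) : PW D p (ng f) := by
  refine ⟨h.1.ng, fun q hq => by rw [vl_ng, h.2.1 q hq, neg_zero], fun g hg hp => ?_⟩
  rcases h.2.2 g hg hp with rfl | rfl
  · right; simp [ShadowPf.ng]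
  · left; rfl

lemma panel_sub {n : ℕ} {D : RootData n} {p c : Set (V n)} (h : IsPanelOf D p c) : p ⊆ c := by
  obtain ⟨-, -, ⟨H, -, rfl⟩, -⟩ := h
  exact Set.inter_subset_left

lemma panel_PW {n : ℕ} {D : RootData n} {p c : Set (V n)} (h : IsPanelOf D p c) :
    ∃ f, PW D p f := by
  obtain ⟨-, -, -, H, ⟨⟨a, ha, k, rfl⟩, hp⟩, hu⟩ := h
  refine ⟨(a, k), ha, fun q hq => (mem_Hy (a, k) q).1 (hp hq), fun g hg hq => ?_⟩
  apply hy_eq (f := (a, k)) ha hg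
  exact hu _ ⟨⟨g.1, hg, g.2, rfl⟩, fun q hq' => (mem_Hy g q).2 (hq q hq')⟩

lemma adj_same {n : ℕ} {D : RootData n} {p : Set (V n)} {x y : V n} {f} (hf : PW D p f)
    (hx : p ⊆ Cl D x) (hy : p ⊆ Cl D y) (hgx : Gen D x) (hgy : Gen D y)
    (hs : vl f x < 0 ↔ vl f y < 0) : Sm D x y := by
  intro g hg hgx'
  by_contra hc
  have hc' : vl g y < 0 := lt_of_le_of_ne (not_lt.mp hc) (hgy g hg)
  have : ∀ q ∈ p, vl g q = 0 := fun q hq =>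
    le_antisymm (Cl_neg (hy hq) hg hc') (hx hq g hg hgx')
  rcases hf.2.2 g hg this with rfl | rfl
  · have := hs.2 hc'; linarith
  · rw [vl_ng] at hgx' hc'
    have := hs.1 (by linarith); linarith

lemma fix_sub {n : ℕ} {D : RootData n} {p : Set (V n)} {x : V n} {f} (hf : PW D p f)
    (hx : p ⊆ Cl D x) : p ⊆ Cl D (sP f x) := by
  intro q hq
  have := Cl_map (hx hq) (sP_mem hf.1)
  rwa [sP_fix (hf.2.1 q hq)] at this

lemma fix_image {n : ℕ} {p : Set (V n)} {f : V n × ℤ} (hf : ∀ q ∈ p, vl f q = 0) :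
    sP f '' p = p := by
  ext q
  constructor
  · rintro ⟨r, hr, rfl⟩; rwa [sP_fix (hf r hr)]
  · intro hq; exact ⟨q, hq, sP_fix (hf q hq)⟩

lemma adj_opp {n : ℕ} {D : RootData n} {p : Set (V n)} {x y : V n} {f} (hf : PW D p f)
    (hx : p ⊆ Cl D x) (hy : p ⊆ Cl D y) (hgx : Gen D x) (hgy : Gen D y)
    (hs : ¬ (vl f x < 0 ↔ vl f y < 0)) : Sm D (sP f x) y := by
  refine adj_same hf (fix_sub hf hx) hy (hgx.map (sP_mem hf.1)) hgy ?_
  rw [vl_sP_self _ hf.1.ne]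
  have h1 := hgx f hf.1
  rcases lt_or_gt_of_ne h1 with h | h
  · have : ¬ vl f y < 0 := fun h' => hs ⟨fun _ => h', fun _ => h⟩
    constructor
    · intro; linarith
    · intro h'; exact absurd h' this
  · have : vl f y < 0 := by
      by_contra h'
      exact hs ⟨fun h'' => by linarith, fun h'' => absurd h'' h'⟩
    exact ⟨fun _ => this, fun _ => by linarith⟩

lemma hyp_image {n : ℕ} {D : RootData n} {g} (hg : g ∈ AffW D) {H : Set (V n)}
    (hH : H ∈ hyperplanes D) : g '' H ∈ hyperplanes D := by
  obtain ⟨a, ha, k, rfl⟩ := hH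
  obtain ⟨f', hf', hp, -⟩ := pl_mem (inv_mem hg) (a, k) ha
  refine ⟨f'.1, hf', f'.2, ?_⟩
  ext v
  rw [mem_Hy, ← hp, ← mem_Hy]
  constructor
  · rintro ⟨w, hw, rfl⟩; simpa using hw
  · intro h; exact ⟨_, h, by simp⟩

lemma face_image {n : ℕ} {D : RootData n} {e : V n × ℤ} (he : Rt D e) {F : Set (V n)}
    (hF : IsFace D F) : IsFace D (sP e '' F) := by
  obtain ⟨v, rfl⟩ := hF
  have hcont : Continuous (sP e) := by
    have : (sP e : V n → V n) = fun v => v - vl e v • coroot e.1 := rfl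
    rw [this]
    have := continuous_vl e
    fun_prop
  let Φ : V n ≃ₜ V n := ⟨sP e, hcont, by
    have : (sP e).symm = sP e := sP_inv e
    show Continuous (sP e).symm
    rw [this]; exact hcont⟩
  refine ⟨sP e v, ?_⟩
  have h1 : ∀ A : Set (V n), sP e '' closure A = closure (sP e '' A) := fun A => Φ.image_closure A
  rw [h1]
  congr 1
  have key : ∀ w u : V n, (∀ α ∈ D.Φ, ∀ k : ℤ,
      (⟪α, w⟫ = (k : ℝ) ↔ ⟪α, u⟫ = (k : ℝ)) ∧ (⟪α, w⟫ < (k : ℝ) ↔ ⟪α, u⟫ < (k : ℝ))) ↔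
      ∀ f, Rt D f → (vl f w = 0 ↔ vl f u = 0) ∧ (vl f w < 0 ↔ vl f u < 0) := by
    intro w u
    simp only [vl, sub_eq_zero, sub_neg, Prod.forall, Rt]
    exact ⟨fun h a k ha => h a ha k, fun h a ha k => h a k ha⟩
  have key2 : ∀ w u : V n, (∀ f, Rt D f → (vl f w = 0 ↔ vl f u = 0) ∧ (vl f w < 0 ↔ vl f u < 0)) →
      ∀ f, Rt D f → (vl f (sP e w) = 0 ↔ vl f (sP e u) = 0) ∧
        (vl f (sP e w) < 0 ↔ vl f (sP e u) < 0) := by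
    intro w u h f hf
    obtain ⟨f', hf', hp, -⟩ := pl_mem (sP_mem he) f hf
    rw [hp, hp]; exact h f' hf'
  ext w
  constructor
  · rintro ⟨w, hw, rfl⟩
    exact (key _ _).2 (key2 _ _ ((key _ _).1 hw))
  · intro hw
    refine ⟨sP e w, (key _ _).2 ?_, sP_sP e w⟩
    have := key2 _ _ ((key _ _).1 hw)
    simpa only [sP_sP] using this

lemma alcove_image {n : ℕ} {D : RootData n} {e : V n × ℤ} (he : Rt D e) {c : Set (V n)}
    (hc : IsAlcove D c) : IsAlcove D (sP e '' c) := by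
  obtain ⟨x, hx, rfl⟩ := alcove_iff.1 hc
  exact alcove_iff.2 ⟨sP e x, hx.map (sP_mem he), Cl_image x (sP_mem he)⟩

lemma panel_image {n : ℕ} {D : RootData n} {e : V n × ℤ} (he : Rt D e) {p c : Set (V n)}
    (h : IsPanelOf D p c) : IsPanelOf D (sP e '' p) (sP e '' c) := by
  obtain ⟨h1, h2, ⟨H, hH, hp⟩, K, ⟨hK, hpK⟩, hu⟩ := h
  refine ⟨alcove_image he h1, face_image he h2, ⟨sP e '' H, hyp_image (sP_mem he) hH, ?_⟩,
    sP e '' K, ⟨hyp_image (sP_mem he) hK, Set.image_mono hpK⟩, ?_⟩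
  · rw [hp, Set.image_inter (sP e).injective]
  · rintro L ⟨hL, hpL⟩
    have hinv : ∀ A : Set (V n), sP e '' (sP e '' A) = A := by
      intro A; rw [Set.image_image]; simp [sP_sP]
    have := hu (sP e '' L) ⟨hyp_image (sP_mem he) hL, by
      rw [← hinv p]; exact Set.image_mono hpL⟩
    rw [← this, hinv]

lemma no_stutter {n : ℕ} {D : RootData n} {γ : PreGallery n} (h : IsMinimal D γ) {i : ℕ}
    (hi : 1 ≤ i) (hil : i ≤ γ.len) : γ.c (i - 1) ≠ γ.c i := by
  intro hst
  obtain ⟨⟨h1, h2, h3, h4⟩, hmin⟩ := h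
  have hlen : γ.len - 1 + 1 = γ.len := by omega
  have := hmin ⟨γ.len - 1, fun k => if k < i then γ.p k else γ.p (k + 1),
    fun k => if k < i then γ.c k else γ.c (k + 1)⟩ ?_ ?_ ?_
  · simp only at this; omega
  · refine ⟨?_, ?_, ?_, ?_⟩
    · intro k hk
      simp only at hk ⊢
      split_ifs
      · exact h1 k (by omega)
      · exact h1 (k + 1) (by omega)
    · simp only [if_pos (show 0 < i by omega)]; exact h2
    · simp only [hlen, if_neg (show ¬ γ.len < i by omega)]
      refine ⟨h3.1, ?_⟩
      split_ifs with hh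
      · have : i = γ.len := by omega
        subst this
        rw [hst]; exact h3.2
      · exact h3.2
    · intro k hk hkl
      simp only at hkl ⊢
      rcases lt_trichotomy k i with hlt | rfl | hgt
      · rw [if_pos hlt, if_pos (show k - 1 < i by omega), if_pos hlt]
        exact h4 k hk (by omega)
      · rw [if_neg (lt_irrefl k), if_pos (show k - 1 < k by omega), if_neg (lt_irrefl k), hst]
        exact h4 (k + 1) (by omega) (by omega)
      · rw [if_neg (show ¬ k < i by omega), if_neg (show ¬ k - 1 < i by omega),
          if_neg (show ¬ k < i by omega)]
        have := h4 (k + 1) (by omega) (by omega)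
        rwa [show k + 1 - 1 = k - 1 + 1 by omega] at this
  · simp only [if_pos (show 0 < i by omega)]
  · simp only [hlen, if_neg (show ¬ γ.len < i by omega)]

/-- Flipping a segment of a minimal gallery gives a minimal gallery. -/
lemma flip_minimal {n : ℕ} {D : RootData n} {γ : PreGallery n} (h : IsMinimal D γ) {f : V n × ℤ}
    (hf : Rt D f) {j i : ℕ} (hj : 1 ≤ j) (hji : j < i) (hil : i ≤ γ.len)
    (hpj : ∀ q ∈ γ.p j, vl f q = 0) (hpi : ∀ q ∈ γ.p i, vl f q = 0) :
    IsMinimal D ⟨γ.len, fun k => if j ≤ k ∧ k < i then sP f '' γ.p k else γ.p k,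
      fun k => if j ≤ k ∧ k < i then sP f '' γ.c k else γ.c k⟩ := by
  obtain ⟨⟨h1, h2, h3, h4⟩, hmin⟩ := h
  refine ⟨⟨?_, ?_, ?_, ?_⟩, ?_⟩
  · intro k hk
    simp only at hk ⊢
    split_ifs
    · exact alcove_image hf (h1 k hk)
    · exact h1 k hk
  · simp only [if_neg (show ¬ (j ≤ 0 ∧ 0 < i) by omega)]; exact h2
  · simp only [if_neg (show ¬ (j ≤ γ.len + 1 ∧ γ.len + 1 < i) by omega),
      if_neg (show ¬ (j ≤ γ.len ∧ γ.len < i) by omega)]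
    exact h3
  · intro k hk hkl
    simp only at hkl ⊢
    obtain ⟨ha, hb⟩ := h4 k hk hkl
    by_cases hA : j ≤ k ∧ k < i
    · rw [if_pos hA, if_pos hA]
      refine ⟨?_, panel_image hf hb⟩
      by_cases hB : j ≤ k - 1
      · rw [if_pos ⟨hB, by omega⟩]; exact panel_image hf ha
      · rw [if_neg (by omega)]
        have : k = j := by omega
        subst this
        rw [fix_image hpj]; exact ha
    · rw [if_neg hA, if_neg hA]
      refine ⟨?_, hb⟩
      by_cases hB : j ≤ k - 1 ∧ k - 1 < i
      · have : k = i := by omega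
        subst this
        rw [if_pos hB]
        have := panel_image hf ha
        rwa [fix_image hpi] at this
      · rw [if_neg hB]; exact ha
  · intro γ' hg h0 hl
    simp only [if_neg (show ¬ (j ≤ 0 ∧ 0 < i) by omega),
      if_neg (show ¬ (j ≤ γ.len + 1 ∧ γ.len + 1 < i) by omega)] at h0 hl ⊢
    exact hmin γ' hg h0 hl

/-- The walls crossed by a minimal gallery are crossed exactly once. -/
lemma minimal_cross {n : ℕ} {D : RootData n} {γ : PreGallery n} (h : IsMinimal D γ)
    {x : ℕ → V n} (hx : ∀ i ≤ γ.len, Gen D (x i) ∧ γ.c i = Cl D (x i)) {i : ℕ}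
    (hi : 1 ≤ i) (hil : i ≤ γ.len) :
    ∃ f, PW D (γ.p i) f ∧ vl f (x 0) < 0 ∧ vl f (x (i - 1)) < 0 ∧ 0 < vl f (x i) ∧
      Sm D (sP f (x i)) (x (i - 1)) := by
  have hpan := h.1.2.2.2
  have hsub : ∀ k, 1 ≤ k → k ≤ γ.len → γ.p k ⊆ Cl D (x (k - 1)) ∧ γ.p k ⊆ Cl D (x k) := by
    intro k hk hkl
    have := hpan k hk hkl
    rw [← (hx k hkl).2, ← (hx (k - 1) (by omega)).2]
    exact ⟨panel_sub this.1, panel_sub this.2⟩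
  obtain ⟨f, hf, hf0⟩ : ∃ f, PW D (γ.p i) f ∧ vl f (x 0) < 0 := by
    obtain ⟨f, hf⟩ := panel_PW (hpan i hi hil).1
    rcases lt_or_gt_of_ne ((hx 0 (by omega)).1 f hf.1) with h0 | h0
    · exact ⟨f, hf, h0⟩
    · exact ⟨ng f, hf.ng, by rw [vl_ng]; linarith⟩
  have hgi := (hx i hil).1
  have hgi' := (hx (i - 1) (by omega)).1
  have hdiff : ¬ (vl f (x i) < 0 ↔ vl f (x (i - 1)) < 0) := by
    intro hs
    have := adj_same hf (hsub i hi hil).2 (hsub i hi hil).1 hgi hgi' hs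
    apply no_stutter h hi hil
    rw [(hx i hil).2, (hx (i - 1) (by omega)).2, Cl_eq_of_Sm hgi this]
  have hSm := adj_opp hf (hsub i hi hil).2 (hsub i hi hil).1 hgi hgi' hdiff
  have hneg : vl f (x (i - 1)) < 0 := by
    by_contra hc
    have hex : ∃ j, ¬ vl f (x j) < 0 := ⟨_, hc⟩
    classical
    set j := Nat.find hex with hjdef
    have hj1 : ¬ vl f (x j) < 0 := Nat.find_spec hex
    have hjle : j ≤ i - 1 := Nat.find_min' hex hc
    have hj0 : 1 ≤ j := by
      rcases Nat.eq_zero_or_pos j with h0 | h0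
      · rw [h0] at hj1; exact absurd hf0 hj1
      · exact h0
    have hj2 : vl f (x (j - 1)) < 0 := by
      by_contra h'
      exact Nat.find_min hex (show j - 1 < Nat.find hex by omega) h'
    have hjl : j ≤ γ.len := by omega
    have hgj := (hx j hjl).1
    have hgj' := (hx (j - 1) (by omega)).1
    have hj1' : 0 < vl f (x j) := lt_of_le_of_ne (not_lt.mp hj1) (hgj f hf.1).symm
    have hpj : ∀ q ∈ γ.p j, vl f q = 0 := fun q hq =>
      le_antisymm (Cl_neg ((hsub j hj0 hjl).1 hq) hf.1 hj2) ((hsub j hj0 hjl).2 hq f hf.1 hj1')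
    have hPWj : PW D (γ.p j) f := by
      obtain ⟨e, he⟩ := panel_PW (hpan j hj0 hjl).1
      rcases he.2.2 f hf.1 hpj with rfl | rfl
      · exact he
      · exact he.ng
    have hfl := flip_minimal h hf.1 hj0 (show j < i by omega) hil hpj hf.2.1
    have hSj := adj_opp hPWj (hsub j hj0 hjl).2 (hsub j hj0 hjl).1 hgj hgj'
      (fun hs => by have := hs.2 hj2; linarith)
    apply no_stutter hfl hj0 hjl
    simp only [if_neg (show ¬ (j ≤ j - 1 ∧ j - 1 < i) by omega),
      if_pos (show j ≤ j ∧ j < i by omega)]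
    rw [(hx j hjl).2, (hx (j - 1) (by omega)).2, Cl_image _ (sP_mem hf.1),
      Cl_eq_of_Sm (hgj.map (sP_mem hf.1)) hSj]
  refine ⟨f, hf, hf0, hneg, ?_, hSm⟩
  by_contra hc
  exact hdiff ⟨fun _ => hneg, fun _ => lt_of_le_of_ne (not_lt.mp hc) (hgi f hf.1)⟩

end ShadowPf

namespace ShadowPf

inductive Down {n : ℕ} (D : RootData n) (b x : V n) : Equiv.Perm (V n) → Prop
  | refl : Down D b x 1
  | step {g : Equiv.Perm (V n)} {f : V n × ℤ} (hg : Down D b x g) (hf : Rt D f)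
      (hb : vl f b < 0) (hx : 0 < vl f (g x)) : Down D b x (sP f * g)

lemma Down.mem {n : ℕ} {D : RootData n} {b x : V n} {g} (h : Down D b x g) : g ∈ AffW D := by
  induction h with
  | refl => exact one_mem _
  | step _ hf _ _ ih => exact mul_mem (sP_mem hf) ih

lemma Down.fold {n : ℕ} {D : RootData n} {b x y : V n} {f} (hf : Rt D f) (hb : vl f b < 0)
    (hx : 0 < vl f x) (hs : Sm D y (sP f x)) {g} (h : Down D b y g) : Down D b x (g * sP f) := by
  induction h with
  | refl => exact (Down.refl.step hf hb hx)
  | step hg hh hhb hhx ih =>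
    rw [mul_assoc]
    exact ih.step hh hhb (hs.map hg.mem _ hh hhx)

lemma Down.cross {n : ℕ} {D : RootData n} {b x y : V n} {f} {p : Set (V n)} (hf : PW D p f)
    (hb : vl f b < 0) (hx : 0 < vl f x) (hs : Sm D y (sP f x)) (hgx : Gen D x)
    (hpx : p ⊆ Cl D x) (hpy : p ⊆ Cl D y) {g} (h : Down D b y g) : Down D b x g := by
  induction h with
  | refl => exact Down.refl
  | @step g h hg hh hhb hhx ih =>
    obtain ⟨f', hf', h1, h2, -⟩ := pl_mem hg.mem h hh
    by_cases hc : 0 < vl h (g x)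
    · exact ih.step hh hhb hc
    · rw [h1] at hc hhx
      have hc' : vl f' x < 0 := lt_of_le_of_ne (not_lt.mp hc) (hgx _ hf')
      have hz : ∀ q ∈ p, vl f' q = 0 := fun q hq =>
        le_antisymm (Cl_neg (hpx hq) hf' hc') (hpy hq f' hf' hhx)
      have : sP f' = sP f := by
        rcases hf.2.2 f' hf' hz with rfl | rfl
        · rfl
        · exact sP_ng f
      rw [h2, this]
      exact hg.fold hf.1 hb hx hs

lemma sP0_mem {n : ℕ} {D : RootData n} {a : V n} (h : a ∈ D.Φ) : sP (a, 0) ∈ FinW D :=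
  Subgroup.subset_closure ⟨a, h, by rw [sP_coe]; simp⟩

lemma affW_decomp {n : ℕ} {D : RootData n} {g} (hg : g ∈ AffW D) :
    ∃ u ∈ FinW D, ∃ t : V n, ∀ v, g v = u v + t := by
  obtain ⟨l, hl, rfl⟩ := words (Rt D) (S := {e : Equiv.Perm (V n) | ∃ α ∈ D.Φ, ∃ k : ℤ,
    ⇑e = sRefl α (k : ℝ)}) (by
      rintro x ⟨a, ha, k, h⟩
      exact ⟨(a, k), ha, by ext1 v; rw [h]; rfl⟩) hg
  clear hg
  induction l with
  | nil => exact ⟨1, one_mem _, 0, by simp⟩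
  | cons f l ih =>
    obtain ⟨u, hu, t, ht⟩ := ih (fun e he => hl e (List.mem_cons_of_mem _ he))
    have hf : Rt D f := hl f List.mem_cons_self
    refine ⟨sP (f.1, 0) * u, mul_mem (sP0_mem hf) hu, t - vl f t • coroot f.1, fun v => ?_⟩
    simp only [List.map_cons, List.prod_cons, Equiv.Perm.mul_apply, ht, sP_apply]
    simp only [vl, inner_add_right]
    push_cast
    module

lemma finW_linear {n : ℕ} {D : RootData n} {g} (hg : g ∈ FinW D) :
    ∃ L : V n →ₗ[ℝ] V n, ∀ v, g v = L v := by
  obtain ⟨l, hl, rfl⟩ := words (fun f => f.2 = 0) (S := {e : Equiv.Perm (V n) | ∃ α ∈ D.Φ,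
    ⇑e = sRefl α 0}) (by
      rintro x ⟨a, ha, h⟩
      exact ⟨(a, 0), rfl, by ext1 v; rw [h, sP_coe]; simp⟩) hg
  clear hg
  induction l with
  | nil => exact ⟨LinearMap.id, by simp⟩
  | cons f l ih =>
    obtain ⟨L, hL⟩ := ih (fun e he => hl e (List.mem_cons_of_mem _ he))
    have hf : f.2 = 0 := hl f List.mem_cons_self
    refine ⟨L - ((innerₗ (V n) f.1).comp L).smulRight (coroot f.1), fun v => ?_⟩
    simp only [List.map_cons, List.prod_cons, Equiv.Perm.mul_apply, hL, sP_apply]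
    simp [vl, hf]

lemma hull_inv {n : ℕ} {D : RootData n} {lam : V n} {u} (hu : u ∈ FinW D) {v : V n}
    (hv : v ∈ convexHull ℝ (W0orbit D lam)) : u v ∈ convexHull ℝ (W0orbit D lam) := by
  obtain ⟨L, hL⟩ := finW_linear hu
  have h1 : L v ∈ L '' convexHull ℝ (W0orbit D lam) := ⟨v, hv, rfl⟩
  rw [LinearMap.image_convexHull] at h1
  rw [hL]
  refine convexHull_mono ?_ h1
  rintro _ ⟨q, ⟨w, hw, rfl⟩, rfl⟩
  exact ⟨u * w, mul_mem hu hw, by simp [hL]⟩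

lemma fix_zero_inv {n : ℕ} {D : RootData n} {lam : V n} {g} (hg : g ∈ AffW D) (h0 : g 0 = 0)
    {v : V n} (hv : v ∈ convexHull ℝ (W0orbit D lam)) :
    g v ∈ convexHull ℝ (W0orbit D lam) := by
  obtain ⟨u, hu, t, ht⟩ := affW_decomp hg
  obtain ⟨L, hL⟩ := finW_linear hu
  have : t = 0 := by
    have := ht 0
    rw [h0, hL, map_zero, zero_add] at this
    exact this.symm
  rw [ht, this, add_zero]
  exact hull_inv hu hv

lemma Down.endpoint {n : ℕ} {D : RootData n} {b x lam : V n} (hb0 : (0 : V n) ∈ Cl D b)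
    (hl : lam ∈ Cl D x) {g} (h : Down D b x g) : g lam ∈ convexHull ℝ (W0orbit D lam) := by
  induction h with
  | refl => exact subset_convexHull _ _ ⟨1, one_mem _, rfl⟩
  | @step g f hg hf hb hx ih =>
    have h1 : vl f 0 ≤ 0 := Cl_neg hb0 hf hb
    have h2 : 0 ≤ vl f (g lam) := Cl_map hl hg.mem f hf hx
    have h3 := hull_inv (sP0_mem (D := D) hf) ih
    rw [Equiv.Perm.mul_apply]
    rw [sP_apply] at h3 ⊢
    simp only [vl, inner_zero_right, Int.cast_zero, sub_zero] at h1 h2 h3 ⊢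
    set a := ⟪f.1, g lam⟫
    by_cases ha : a = 0
    · have hk : (f.2 : ℝ) = 0 := by linarith
      rw [ha, hk]; simpa using ih
    · have ha' : 0 < a := lt_of_le_of_ne (by linarith) (Ne.symm ha)
      have := (convex_convexHull ℝ (W0orbit D lam)) ih h3
        (show 0 ≤ (f.2 : ℝ) / a from div_nonneg (by linarith) ha'.le)
        (show 0 ≤ (a - f.2) / a from div_nonneg (by linarith) ha'.le) (by field_simp; ring)
      convert this using 1
      have e : (a - f.2) = ((a - f.2) / a) * a := by field_simp
      have e2 : (f.2 : ℝ) / a = 1 - (a - f.2) / a := by field_simp; ring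
      rw [e2]
      generalize (a - f.2) / a = c at e
      rw [e]
      module

/-- Two faces of one alcove of the same type coincide. -/
lemma face_eq {n : ℕ} {D : RootData n} {x : V n} (hx : Gen D x) {w z} (hw : w ∈ AffW D)
    (hz : z ∈ AffW D) {p : Set (V n)} (h1 : p ⊆ Cl D x) (h2 : z '' p ⊆ Cl D (w x)) :
    ∀ q ∈ p, z q = w q := by
  intro q hq
  have := fund_dom (hx.map hw) (g := z * w⁻¹) (mul_mem hz (inv_mem hw)) (q := w q)
    (Cl_map (h1 hq) hw) (by simpa using h2 ⟨q, hq, rfl⟩)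
  simpa using this

lemma step_aux {n : ℕ} {D : RootData n} {γ γ' : PreGallery n} (h : IsMinimal D γ)
    (hγ' : IsGallery D γ') (ht : SameTypeGallery D γ γ') {x : ℕ → V n}
    (hx : ∀ i ≤ γ.len, Gen D (x i) ∧ γ.c i = Cl D (x i)) {w0} (hw0 : w0 ∈ AffW D)
    (h0 : γ'.c 0 = Cl D (w0 (x 0))) (i : ℕ) (hi : i ≤ γ.len) :
    ∃ g, Down D (x 0) (x i) g ∧ γ'.c i = Cl D ((w0 * g) (x i)) := by
  induction i with
  | zero => exact ⟨1, Down.refl, by simpa using h0⟩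
  | succ i ih =>
    obtain ⟨g, hg, hc⟩ := ih (by omega)
    obtain ⟨f, hf, hfb, hfy, hfx, hs⟩ := minimal_cross h hx (i := i + 1) (by omega) hi
    rw [Nat.add_sub_cancel] at hfy hs
    have hP := h.1.2.2.2 (i + 1) (by omega) hi
    have hP' := hγ'.2.2.2 (i + 1) (by omega) (by rw [← ht.1]; exact hi)
    rw [Nat.add_sub_cancel] at hP hP'
    obtain ⟨gx, cx⟩ := hx (i + 1) hi
    obtain ⟨gy, cy⟩ := hx i (by omega)
    have hpx := panel_sub hP.2
    have hpy := panel_sub hP.1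
    rw [cx] at hpx
    rw [cy] at hpy
    have hs' : Sm D (x i) (sP f (x (i + 1))) := hs.symm (gx.map (sP_mem hf.1))
    set w := w0 * g with hw
    have hwm : w ∈ AffW D := mul_mem hw0 hg.mem
    obtain ⟨z, hz, hzp⟩ := ht.2 (i + 1) (by omega)
    have hp1 := panel_sub hP'.1
    have hp2 := panel_sub hP'.2
    rw [hc] at hp1
    have hzw := face_eq gy hwm hz hpy (by rw [← hzp]; exact hp1)
    obtain ⟨x', gx', cx'⟩ := alcove_iff.1 hP'.2.1
    rw [cx'] at hp2
    obtain ⟨e', he'⟩ := panel_PW hP'.2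
    obtain ⟨e, he, hpl, hpl2, -⟩ := pl_mem hwm e' he'.1
    have hsame : sP e = sP f := by
      rcases hf.2.2 e he (fun q hq => by
        rw [← hpl, ← hzw q hq]
        exact he'.2.1 _ (by rw [hzp]; exact ⟨q, hq, rfl⟩)) with rfl | rfl
      · rfl
      · exact sP_ng f
    rw [hsame] at hpl2
    by_cases hss : vl e' (w (x i)) < 0 ↔ vl e' x' < 0
    · have := adj_same he' hp1 hp2 (gy.map hwm) gx' hss
      refine ⟨g * sP f, hg.fold hf.1 hfb hfx hs', ?_⟩
      rw [cx', ← Cl_eq_of_Sm (gy.map hwm) this, ← mul_assoc, ← hw, Equiv.Perm.mul_apply]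
      exact Cl_eq_of_Sm (gy.map hwm) (hs'.map hwm)
    · have := adj_opp he' hp1 hp2 (gy.map hwm) gx' hss
      refine ⟨g, hg.cross hf hfb hfx hs' gx hpx hpy, ?_⟩
      rw [← Equiv.Perm.mul_apply, hpl2, Equiv.Perm.mul_apply] at this
      have g2 := (gy.map (sP_mem hf.1)).map hwm
      rw [cx', ← Cl_eq_of_Sm g2 this, ← hw]
      have h5 := hs'.map (sP_mem hf.1)
      rw [sP_sP] at h5
      exact Cl_eq_of_Sm g2 (h5.map hwm)

end ShadowPf

/-- Corollary: the shadow of a coroot lattice element `λ` with respect to the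
orientation induced by any alcove is contained in the `λ`-Weyl polytope. -/
theorem shadow_subset_weylPolytope {n : ℕ} (D : RootData n)
    (lam : V n) (hlam : lam ∈ corootLattice D) (y : AffW D)
    (γ : PreGallery n) (hmin : IsMinimal D γ)
    (hfirst : γ.p 0 = {(0 : V n)}) (hlast : γ.p (γ.len + 1) = {lam}) :
    VShadow D (alcoveOrient D (actW y (fund D))) γ ⊆
      convexHull ℝ (W0orbit D lam) := by
  rintro μ ⟨γ', hγ', ht, hp0, -, hμ⟩
  have hex : ∀ i, ∃ x, i ≤ γ.len → ShadowPf.Gen D x ∧ γ.c i = ShadowPf.Cl D x := by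
    intro i
    by_cases hi : i ≤ γ.len
    · obtain ⟨x, hx⟩ := ShadowPf.alcove_iff.1 (hmin.1.1 i hi)
      exact ⟨x, fun _ => hx⟩
    · exact ⟨0, fun h => absurd h hi⟩
  choose x hx using hex
  obtain ⟨gx0, cx0⟩ := hx 0 (Nat.zero_le _)
  obtain ⟨x', gx', cx'⟩ := ShadowPf.alcove_iff.1 (hγ'.1 0 (Nat.zero_le _))
  have hz : (0 : V n) ∈ ShadowPf.Cl D (x 0) := by
    rw [← cx0]; exact hmin.1.2.1.2 (by rw [hfirst]; rfl)
  have hz' : (0 : V n) ∈ ShadowPf.Cl D x' := by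
    rw [← cx']; exact hγ'.2.1.2 (by rw [hp0, hfirst]; rfl)
  obtain ⟨w0, hw0, hsm⟩ := ShadowPf.trans_aux gx' _ (x 0) gx0 le_rfl
  have hcl := ShadowPf.Cl_eq_of_Sm gx' hsm
  have hw00 : w0 0 = 0 := by
    refine ShadowPf.fund_dom gx' hw0 hz' ?_
    rw [hcl]; exact ShadowPf.Cl_map hz hw0
  obtain ⟨g, hg, hc⟩ := ShadowPf.step_aux hmin hγ' ht hx hw0 (by rw [cx', hcl]) γ.len le_rfl
  obtain ⟨gl, cl⟩ := hx γ.len le_rfl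
  have hlm : lam ∈ ShadowPf.Cl D (x γ.len) := by
    rw [← cl]; exact hmin.1.2.2.1.2 (by rw [hlast]; rfl)
  obtain ⟨z, hzm, hzp⟩ := ht.2 (γ.len + 1) le_rfl
  have hsub := hγ'.2.2.1.2
  rw [← ht.1, hzp, hc] at hsub
  have hf := ShadowPf.face_eq gl (mul_mem hw0 hg.mem) hzm (p := γ.p (γ.len + 1))
    (by rw [hlast]; simpa using hlm) hsub lam (by rw [hlast]; rfl)
  rw [← ht.1, hzp, hlast, Set.image_singleton, Set.singleton_eq_singleton_iff] at hμ
  rw [hμ, hf, Equiv.Perm.mul_apply]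
  exact ShadowPf.fix_zero_inv hw0 hw00 (hg.endpoint hz hlm)
end

section
/- Let λ ∈ R^∨, let φ be any orientation of V, and let γ_λ be any minimal gallery from the origin to λ. Then every combinatorial gallery of the same type as γ_λ, with first face the origin, that is positively folded with respect to φ has its final vertex in Conv(W₀·λ), the convex hull of the W₀-orbit of λ. That is, the shadow of λ with respect to any orientation is contained in the λ-Weyl polytope. -/
open scoped RealInnerProductSpace
open scoped Classical

namespace Shd
variable {n : ℕ}

lemma ap_inv (g : Equiv.Perm (V n)) (v : V n) : g (g⁻¹ v) = v := g.apply_symm_apply v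

lemma inv_ap (g : Equiv.Perm (V n)) (v : V n) : g⁻¹ (g v) = v := g.symm_apply_apply v

lemma inner_coroot {α : V n} (h : α ≠ 0) : ⟪α, coroot α⟫ = (2 : ℝ) := by
  have : ⟪α, α⟫ ≠ (0 : ℝ) := by simpa using h
  unfold coroot
  rw [inner_smul_right]; field_simp

lemma sRefl_inv (α : V n) (k : ℝ) : Function.Involutive (sRefl α k) := by
  intro v
  by_cases h : α = 0
  · subst h; simp [sRefl, coroot]
  · have h2 := inner_coroot h
    unfold sRefl
    rw [inner_sub_right, inner_smul_right, h2]
    module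

/-- The affine reflection as a permutation. -/
noncomputable def sP (α : V n) (k : ℝ) : Equiv.Perm (V n) := (sRefl_inv α k).toPerm

@[simp] lemma sP_coe (α : V n) (k : ℝ) : ⇑(sP α k) = sRefl α k := rfl

lemma sP_sP (α : V n) (k : ℝ) (v : V n) : sP α k (sP α k v) = v := sRefl_inv α k v

lemma sP_mul_self (α : V n) (k : ℝ) : sP α k * sP α k = 1 := by
  ext1 v; exact sP_sP α k v

lemma sP_inv (α : V n) (k : ℝ) : (sP α k)⁻¹ = sP α k :=
  inv_eq_of_mul_eq_one_left (sP_mul_self α k)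

lemma sP_apply (α : V n) (k : ℝ) (v : V n) : sP α k v = v - (⟪α, v⟫ - k) • coroot α := rfl

lemma inner_sP {α : V n} (h : α ≠ 0) (k : ℝ) (v : V n) :
    ⟪α, sP α k v⟫ - k = -(⟪α, v⟫ - k) := by
  rw [sP_apply, inner_sub_right, inner_smul_right, inner_coroot h]; ring

lemma sP_fix {α : V n} {k : ℝ} {v : V n} (h : ⟪α, v⟫ = k) : sP α k v = v := by
  rw [sP_apply, h]; simp

lemma sP_neg (α : V n) (k : ℝ) : sP (-α) (-k) = sP α k := by
  ext1 v
  simp only [sP_apply, coroot, inner_neg_left, inner_neg_right]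
  simp only [neg_neg, smul_neg, smul_smul]
  module

lemma sP_mem (D : RootData n) {α : V n} (h : α ∈ D.Φ) (k : ℤ) : sP α k ∈ AffW D :=
  Subgroup.subset_closure ⟨α, h, k, rfl⟩

lemma sP_mem0 (D : RootData n) {α : V n} (h : α ∈ D.Φ) : sP α 0 ∈ FinW D :=
  Subgroup.subset_closure ⟨α, h, rfl⟩

/-- `g` transports the hyperplane `(α,k)` to `(β,m)`. -/
def Trans (g : Equiv.Perm (V n)) (α : V n) (k : ℤ) (α' : V n) (k' : ℤ) : Prop :=
  (∀ v, ⟪α', g v⟫ - (k' : ℝ) = ⟪α, v⟫ - (k : ℝ)) ∧ g * sP α k * g⁻¹ = sP α' k'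

lemma trans_gen (D : RootData n) {β : V n} (hβ : β ∈ D.Φ) (b : ℤ) {α : V n} (hα : α ∈ D.Φ) (k : ℤ) :
    ∃ α' ∈ D.Φ, ∃ k' : ℤ, Trans (sP β b) α k α' k' := by
  obtain ⟨m, hm⟩ := D.crystallographic β hβ α hα
  have hb : ⟪β, β⟫ ≠ (0 : ℝ) := by simpa using D.nonzero β hβ
  have ha : ⟪α, α⟫ ≠ (0 : ℝ) := by simpa using D.nonzero α hα
  have hmem := D.reflect_mem β hβ α hα
  rw [hm] at hmem
  have hm' : (2 * ⟪β, α⟫ : ℝ) = m * ⟪β, β⟫ := by field_simp at hm; linarith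
  refine ⟨_, hmem, k - m * b, ?_, ?_⟩
  · intro v
    simp only [sP_apply, coroot, inner_sub_left, inner_sub_right, inner_smul_left, inner_smul_right]
    have : ⟪α, β⟫ = ⟪β, α⟫ := real_inner_comm _ _
    have h3 : ⟪β, α⟫ = (m * ⟪β, β⟫ / 2 : ℝ) := by linarith
    rw [this, h3]
    push_cast
    simp only [conj_trivial]
    field_simp
    ring
  · rw [sP_inv]
    ext1 v
    have : ⟪α, β⟫ = ⟪β, α⟫ := real_inner_comm _ _
    have h3 : ⟪β, α⟫ = (m * ⟪β, β⟫ / 2 : ℝ) := by linarith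
    have hn : ⟪α - (m : ℝ) • β, α - (m : ℝ) • β⟫ = ⟪α, α⟫ := by
      simp only [inner_sub_left, inner_sub_right, inner_smul_left, inner_smul_right, this, h3]
      simp; ring
    have hc : coroot (α - (m : ℝ) • β) = coroot α - (2 / ⟪α, α⟫ * m) • β := by
      unfold coroot; rw [hn]; module
    simp only [Equiv.Perm.mul_apply, sP_apply]
    rw [hc]
    simp only [coroot, inner_sub_left, inner_sub_right, inner_smul_left, inner_smul_right, this, h3]
    simp only [conj_trivial]
    push_cast
    match_scalars
    · field_simp
    · field_simp
      ring
    · field_simp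
      ring

lemma trans_mul {x y : Equiv.Perm (V n)} {a a1 a2 : V n} {k k1 k2 : ℤ}
    (h1 : Trans y a k a1 k1) (h2 : Trans x a1 k1 a2 k2) : Trans (x * y) a k a2 k2 := by
  refine ⟨?_, ?_⟩
  · intro v; rw [Equiv.Perm.mul_apply, h2.1, h1.1]
  · rw [← h2.2, ← h1.2]; group

lemma trans_ex' (D : RootData n) {g : Equiv.Perm (V n)} (hg : g ∈ AffW D) :
    (∀ α ∈ D.Φ, ∀ k : ℤ, ∃ α' ∈ D.Φ, ∃ k' : ℤ, Trans g α k α' k') ∧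
    (∀ α ∈ D.Φ, ∀ k : ℤ, ∃ α' ∈ D.Φ, ∃ k' : ℤ, Trans g⁻¹ α k α' k') := by
  induction hg using Subgroup.closure_induction with
  | mem x hx =>
    obtain ⟨β, hβ, b, h⟩ := hx
    have : x = sP β b := by ext1 v; rw [h]; rfl
    rw [this, sP_inv]
    exact ⟨fun α hα k => trans_gen D hβ b hα k, fun α hα k => trans_gen D hβ b hα k⟩
  | one => exact ⟨fun α hα k => ⟨α, hα, k, by simp [Trans]⟩, fun α hα k => ⟨α, hα, k, by simp [Trans]⟩⟩
  | mul x y hx hy ihx ihy =>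
    constructor
    · intro α hα k
      obtain ⟨a1, h1, k1, t1⟩ := ihy.1 α hα k
      obtain ⟨a2, h2, k2, t2⟩ := ihx.1 _ h1 k1
      exact ⟨a2, h2, k2, trans_mul t1 t2⟩
    · intro α hα k
      obtain ⟨a1, h1, k1, t1⟩ := ihx.2 α hα k
      obtain ⟨a2, h2, k2, t2⟩ := ihy.2 _ h1 k1
      rw [mul_inv_rev]
      exact ⟨a2, h2, k2, trans_mul t1 t2⟩
  | inv x hx ih => rw [inv_inv]; exact ⟨ih.2, ih.1⟩

lemma trans_ex (D : RootData n) {g : Equiv.Perm (V n)} (hg : g ∈ AffW D) {α : V n}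
    (hα : α ∈ D.Φ) (k : ℤ) : ∃ α' ∈ D.Φ, ∃ k' : ℤ, Trans g α k α' k' :=
  (trans_ex' D hg).1 α hα k

/-- Pull back of a hyperplane. -/
lemma trans_pull (D : RootData n) {g : Equiv.Perm (V n)} (hg : g ∈ AffW D) {α : V n}
    (hα : α ∈ D.Φ) (k : ℤ) : ∃ α' ∈ D.Φ, ∃ k' : ℤ, Trans g α' k' α k := by
  obtain ⟨a, ha, m, h1, h2⟩ := (trans_ex' D hg).2 α hα k
  refine ⟨a, ha, m, ?_, ?_⟩
  · intro v
    have := h1 (g v)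
    simp at this
    linarith
  · rw [← h2]; group

lemma Trans.image_Hy {g : Equiv.Perm (V n)} {a a' : V n} {k k' : ℤ} (h : Trans g a k a' k') :
    g '' Hy a k = Hy a' k' := by
  ext v
  constructor
  · rintro ⟨w, hw, rfl⟩
    have := h.1 w
    simp only [Hy, Set.mem_ofPred_eq] at hw ⊢
    linarith
  · intro hv
    refine ⟨g⁻¹ v, ?_, by simp⟩
    have := h.1 (g⁻¹ v)
    simp only [Hy, Set.mem_ofPred_eq] at hv ⊢
    rw [ap_inv] at this
    linarith

/-- Every element of the affine Weyl group is continuous. -/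
lemma cont_of_mem (D : RootData n) {g : Equiv.Perm (V n)} (hg : g ∈ AffW D) :
    Continuous g ∧ Continuous (g⁻¹ : Equiv.Perm (V n)) := by
  induction hg using Subgroup.closure_induction with
  | mem x hx =>
    obtain ⟨β, hβ, b, h⟩ := hx
    have : x = sP β b := by ext1 v; rw [h]; rfl
    rw [this, sP_inv]
    have : Continuous (sP β (b : ℝ)) := by
      rw [sP_coe]; unfold sRefl; fun_prop
    exact ⟨this, this⟩
  | one => exact ⟨continuous_id, continuous_id⟩
  | mul x y hx hy ihx ihy =>
    rw [mul_inv_rev]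
    exact ⟨ihx.1.comp ihy.1, ihy.2.comp ihx.2⟩
  | inv x hx ih => rw [inv_inv]; exact ⟨ih.2, ih.1⟩

/-- The linear part of an element of the affine Weyl group lies in the finite Weyl group. -/
lemma finW_linear (D : RootData n) {w : Equiv.Perm (V n)} (hw : w ∈ FinW D) :
    ∃ L : V n →ₗ[ℝ] V n, ∀ v, w v = L v := by
  suffices h : (∃ L : V n →ₗ[ℝ] V n, ∀ v, w v = L v) ∧ (∃ L : V n →ₗ[ℝ] V n, ∀ v, w⁻¹ v = L v) from h.1
  induction hw using Subgroup.closure_induction with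
  | mem x hx =>
    obtain ⟨β, hβ, h⟩ := hx
    have : x = sP β 0 := by ext1 v; rw [h]; rfl
    rw [this, sP_inv]
    have : ∃ L : V n →ₗ[ℝ] V n, ∀ v, sP β 0 v = L v := by
      refine ⟨LinearMap.id - (innerₗ (V n) β).smulRight (coroot β), fun v => ?_⟩
      simp [sRefl]
    exact ⟨this, this⟩
  | one => exact ⟨⟨LinearMap.id, fun _ => rfl⟩, ⟨LinearMap.id, fun _ => rfl⟩⟩
  | mul x y hx hy ihx ihy =>
    obtain ⟨⟨L1, h1⟩, ⟨L2, h2⟩⟩ := ihx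
    obtain ⟨⟨L3, h3⟩, ⟨L4, h4⟩⟩ := ihy
    rw [mul_inv_rev]
    exact ⟨⟨L1 ∘ₗ L3, fun v => by simp [h1, h3]⟩,
      ⟨L4 ∘ₗ L2, fun v => by rw [Equiv.Perm.mul_apply, h2, h4]; rfl⟩⟩
  | inv x hx ih => rw [inv_inv]; exact ⟨ih.2, ih.1⟩

lemma linear_part (D : RootData n) {g : Equiv.Perm (V n)} (hg : g ∈ AffW D) :
    ∃ w ∈ FinW D, ∃ t : V n, ∀ v, g v = w v + t := by
  induction hg using Subgroup.closure_induction with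
  | mem x hx =>
    obtain ⟨β, hβ, b, h⟩ := hx
    have : x = sP β b := by ext1 v; rw [h]; rfl
    refine ⟨sP β 0, sP_mem0 D hβ, (b : ℝ) • coroot β, fun v => ?_⟩
    rw [this, sP_apply, sP_apply]; module
  | one => exact ⟨1, one_mem _, 0, fun v => by simp⟩
  | mul x y hx hy ihx ihy =>
    obtain ⟨w1, m1, t1, h1⟩ := ihx
    obtain ⟨w2, m2, t2, h2⟩ := ihy
    obtain ⟨L, hL⟩ := finW_linear D m1
    refine ⟨w1 * w2, mul_mem m1 m2, L t2 + t1, fun v => ?_⟩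
    rw [Equiv.Perm.mul_apply, h2, h1, hL, map_add, Equiv.Perm.mul_apply, hL]; abel
  | inv x hx ih =>
    obtain ⟨w, m, t, h⟩ := ih
    obtain ⟨L, hL⟩ := finW_linear D (inv_mem m)
    refine ⟨w⁻¹, inv_mem m, - L t, fun v => ?_⟩
    have h1 := h (x⁻¹ v)
    rw [ap_inv] at h1
    have h2 : w (x⁻¹ v) = v - t := eq_sub_of_add_eq h1.symm
    have h3 : x⁻¹ v = w⁻¹ (v - t) := by rw [← h2]; simp
    rw [h3, hL, map_sub, hL]; abel

/-- An element of the affine Weyl group fixing the origin lies in the finite Weyl group. -/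
lemma mem_finW_of_fix (D : RootData n) {g : Equiv.Perm (V n)} (hg : g ∈ AffW D) (h0 : g 0 = 0) :
    g ∈ FinW D := by
  obtain ⟨w, m, t, h⟩ := linear_part D hg
  obtain ⟨L, hL⟩ := finW_linear D m
  have := h 0
  rw [hL, L.map_zero, zero_add, h0] at this
  have : g = w := by ext1 v; rw [h, ← this, add_zero]
  rwa [this]

/-- The hyperplane determines the root up to sign. -/
lemma Hy_eq (D : RootData n) {α β : V n} (hα : α ∈ D.Φ) (hβ : β ∈ D.Φ) {k m : ℤ}
    (h : Hy α (k : ℝ) = Hy β (m : ℝ)) : (β = α ∧ m = k) ∨ (β = -α ∧ m = -k) := by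
  have ha : ⟪α, α⟫ ≠ (0 : ℝ) := by simpa using D.nonzero α hα
  set a0 : V n := ((k : ℝ) / ⟪α, α⟫) • α
  set d : V n := β - (⟪α, β⟫ / ⟪α, α⟫) • α with hd
  have hdα : ⟪α, d⟫ = (0 : ℝ) := by
    rw [hd, inner_sub_right, inner_smul_right]; field_simp; ring
  have h0 : ⟪α, a0⟫ = (k : ℝ) := by rw [inner_smul_right]; field_simp
  have h1 : a0 ∈ Hy β (m : ℝ) := by rw [← h]; exact h0
  have h2 : a0 + d ∈ Hy β (m : ℝ) := by
    rw [← h]; simp only [Hy, Set.mem_ofPred_eq]; rw [inner_add_right, h0, hdα, add_zero]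
  simp only [Hy, Set.mem_ofPred_eq] at h1 h2
  rw [inner_add_right, h1] at h2
  have h3 : ⟪β, d⟫ = (0 : ℝ) := by linarith
  have h4 : ⟪d, d⟫ = (0 : ℝ) := by
    nth_rewrite 1 [hd]; rw [inner_sub_left, h3, inner_smul_left, hdα]; simp
  have h5 : d = 0 := by simpa using h4
  have h6 : β = (⟪α, β⟫ / ⟪α, α⟫ : ℝ) • α := by rw [hd] at h5; exact sub_eq_zero.mp h5
  rcases D.reduced α hα (⟪α, β⟫ / ⟪α, α⟫ : ℝ) (h6 ▸ hβ) with hc | hc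
  · left
    rw [hc, one_smul] at h6
    subst h6
    refine ⟨rfl, ?_⟩
    have : (m : ℝ) = k := by rw [← h1, h0]
    exact_mod_cast this
  · right
    rw [hc, neg_smul, one_smul] at h6
    subst h6
    refine ⟨rfl, ?_⟩
    rw [inner_neg_left, h0] at h1
    exact_mod_cast h1.symm

lemma Hy_eq_sP (D : RootData n) {α β : V n} (hα : α ∈ D.Φ) (hβ : β ∈ D.Φ) {k m : ℤ}
    (h : Hy α (k : ℝ) = Hy β (m : ℝ)) : sP β (m : ℝ) = sP α (k : ℝ) := by
  rcases Hy_eq D hα hβ h with ⟨rfl, rfl⟩ | ⟨rfl, rfl⟩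
  · rfl
  · push_cast; exact sP_neg _ _

end Shd

namespace Shd
variable {n : ℕ}

/-- A point on no hyperplane. -/
def Gen (D : RootData n) (v : V n) : Prop := ∀ α ∈ D.Φ, ∀ k : ℤ, ⟪α, v⟫ ≠ (k : ℝ)

/-- The closed alcove around a generic point. -/
def Cl (D : RootData n) (v : V n) : Set (V n) :=
  {w | ∀ α ∈ D.Φ, ∀ k : ℤ, ⟪α, v⟫ < (k : ℝ) → ⟪α, w⟫ ≤ (k : ℝ)}

/-- The open alcove around a generic point. -/
def Op (D : RootData n) (v : V n) : Set (V n) :=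
  {w | ∀ α ∈ D.Φ, ∀ k : ℤ, ⟪α, v⟫ < (k : ℝ) → ⟪α, w⟫ < (k : ℝ)}

lemma gen_iff (D : RootData n) (v : V n) : v ∈ (wallUnion D)ᶜ ↔ Gen D v := by
  simp [wallUnion, Gen, Hy]

lemma Cl_ge {D : RootData n} {v w : V n} (h : w ∈ Cl D v) {α : V n} (hα : α ∈ D.Φ) {k : ℤ}
    (hk : (k : ℝ) < ⟪α, v⟫) : (k : ℝ) ≤ ⟪α, w⟫ := by
  have := h (-α) (D.neg_mem α hα) (-k)
  simp only [inner_neg_left] at this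
  push_cast at this
  have := this (by linarith)
  linarith

lemma Op_gt {D : RootData n} {v w : V n} (h : w ∈ Op D v) {α : V n} (hα : α ∈ D.Φ) {k : ℤ}
    (hk : (k : ℝ) < ⟪α, v⟫) : (k : ℝ) < ⟪α, w⟫ := by
  have := h (-α) (D.neg_mem α hα) (-k)
  simp only [inner_neg_left] at this
  push_cast at this
  have := this (by linarith)
  linarith

lemma self_mem_Cl (D : RootData n) (v : V n) : v ∈ Cl D v := fun _ _ _ h => h.le

lemma self_mem_Op (D : RootData n) (v : V n) : v ∈ Op D v := fun _ _ _ h => h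

lemma Op_gen {D : RootData n} {v w : V n} (hv : Gen D v) (hw : w ∈ Op D v) : Gen D w := by
  intro α hα k
  rcases lt_or_gt_of_ne (hv α hα k) with h | h
  · exact (hw α hα k h).ne
  · exact (Op_gt hw hα h).ne'

lemma Op_convex (D : RootData n) (v : V n) : Convex ℝ (Op D v) := by
  intro x hx y hy a b ha hb hab α hα k hk
  have h1 := hx α hα k hk
  have h2 := hy α hα k hk
  rw [inner_add_right, inner_smul_right, inner_smul_right]
  rcases eq_or_lt_of_le ha with rfl | ha
  · simp at hab; subst hab; simpa using h2
  · have : b = 1 - a := by linarith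
    subst this
    nlinarith

lemma comp_eq (D : RootData n) {v : V n} (hv : Gen D v) :
    connectedComponentIn (wallUnion D)ᶜ v = Op D v := by
  apply Set.Subset.antisymm
  · intro w hw α hα k hk
    by_contra hcon
    push Not at hcon
    have hpre := (isPreconnected_connectedComponentIn (F := (wallUnion D)ᶜ) (x := v)).image
      (fun x => ⟪α, x⟫) (by fun_prop)
    have hoc := hpre.ordConnected
    have hv' : v ∈ connectedComponentIn (wallUnion D)ᶜ v :=
      mem_connectedComponentIn ((gen_iff D v).2 hv)
    have := hoc.out ⟨v, hv', rfl⟩ ⟨w, hw, rfl⟩ ⟨hk.le, hcon⟩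
    obtain ⟨x, hx, hxk⟩ := this
    exact (gen_iff D x).1 (connectedComponentIn_subset _ _ hx) α hα k hxk
  · apply (Op_convex D v).isPreconnected.subset_connectedComponentIn (self_mem_Op D v)
    intro w hw
    exact (gen_iff D w).2 (Op_gen hv hw)

lemma closure_Op (D : RootData n) (v : V n) : closure (Op D v) = Cl D v := by
  apply Set.Subset.antisymm
  · apply closure_minimal
    · intro w hw α hα k hk
      exact (hw α hα k hk).le
    · have : Cl D v = ⋂ α ∈ D.Φ, ⋂ k : ℤ, ⋂ (_ : ⟪α, v⟫ < (k : ℝ)), {w | ⟪α, w⟫ ≤ (k : ℝ)} := by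
        ext w; simp [Cl]
      rw [this]
      refine isClosed_biInter fun α _ => isClosed_iInter fun k => isClosed_iInter fun _ => ?_
      exact isClosed_le (by fun_prop) (by fun_prop)
  · intro w hw
    have hlim : Filter.Tendsto (fun t : ℝ => w + t • (v - w)) (nhdsWithin 0 (Set.Ioi 0)) (nhds w) := by
      have : Filter.Tendsto (fun t : ℝ => w + t • (v - w)) (nhds 0) (nhds (w + (0:ℝ) • (v - w))) :=
        Continuous.tendsto (by fun_prop) 0
      simp only [zero_smul, add_zero] at this
      exact this.mono_left nhdsWithin_le_nhds
    refine mem_closure_of_tendsto hlim ?_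
    filter_upwards [Ioo_mem_nhdsGT (show (0:ℝ) < 1 by norm_num)] with t ht α hα k hk
    have h1 := hw α hα k hk
    rw [inner_add_right, inner_smul_right, inner_sub_right]
    nlinarith [ht.1, ht.2]

lemma alcove_iff (D : RootData n) (c : Set (V n)) :
    IsAlcove D c ↔ ∃ v, Gen D v ∧ c = Cl D v := by
  unfold IsAlcove
  constructor
  · rintro ⟨v, hv, rfl⟩
    have hv := (gen_iff D v).1 hv
    exact ⟨v, hv, by rw [comp_eq D hv, closure_Op]⟩
  · rintro ⟨v, hv, rfl⟩
    exact ⟨v, (gen_iff D v).2 hv, by rw [comp_eq D hv, closure_Op]⟩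

lemma side (D : RootData n) {c : Set (V n)} (hc : IsAlcove D c) {α : V n} (hα : α ∈ D.Φ) (k : ℤ) :
    c ⊆ Hle α k ∨ c ⊆ Hge α k := by
  obtain ⟨v, hv, rfl⟩ := (alcove_iff D c).1 hc
  rcases lt_or_gt_of_ne (hv α hα k) with h | h
  · left; intro w hw; exact hw α hα k h
  · right; intro w hw; exact Cl_ge hw hα h

lemma not_both (D : RootData n) {c : Set (V n)} (hc : IsAlcove D c) {α : V n} (hα : α ∈ D.Φ) {k : ℤ}
    (h1 : c ⊆ Hle α k) (h2 : c ⊆ Hge α k) : False := by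
  obtain ⟨v, hv, rfl⟩ := (alcove_iff D c).1 hc
  exact hv α hα k (le_antisymm (h1 (self_mem_Cl D v)) (h2 (self_mem_Cl D v)))

lemma Hle_neg (α : V n) (k : ℤ) : Hle (-α) ((-k : ℤ) : ℝ) = Hge α k := by
  ext v; simp [Hle, Hge, inner_neg_left]

lemma Hge_neg (α : V n) (k : ℤ) : Hge (-α) ((-k : ℤ) : ℝ) = Hle α k := by
  ext v; simp [Hle, Hge, inner_neg_left]

lemma Trans.image_Hle {g : Equiv.Perm (V n)} {a a' : V n} {k k' : ℤ} (h : Trans g a k a' k')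
    (c : Set (V n)) : g '' c ⊆ Hle a' k' ↔ c ⊆ Hle a k := by
  rw [Set.image_subset_iff]
  constructor
  all_goals
    intro hc v hv
    have h1 := h.1 v
    have h2 := hc hv
    simp only [Hle, Set.mem_preimage, Set.mem_ofPred_eq] at h2 ⊢
    linarith

lemma Trans.image_Hge {g : Equiv.Perm (V n)} {a a' : V n} {k k' : ℤ} (h : Trans g a k a' k')
    (c : Set (V n)) : g '' c ⊆ Hge a' k' ↔ c ⊆ Hge a k := by
  rw [Set.image_subset_iff]
  constructor
  all_goals
    intro hc v hv
    have h1 := h.1 v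
    have h2 := hc hv
    simp only [Hge, Set.mem_preimage, Set.mem_ofPred_eq] at h2 ⊢
    linarith

lemma sP_swap (D : RootData n) {α : V n} (hα : α ∈ D.Φ) (k : ℤ) (c : Set (V n)) :
    (sP α k '' c ⊆ Hle α k ↔ c ⊆ Hge α k) ∧ (sP α k '' c ⊆ Hge α k ↔ c ⊆ Hle α k) := by
  have h := inner_sP (D.nonzero α hα) (k : ℝ)
  refine ⟨⟨?_, ?_⟩, ⟨?_, ?_⟩⟩
  all_goals
    intro hc
    first | rw [Set.image_subset_iff] at hc | rw [Set.image_subset_iff]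
    intro v hv
    have h1 := h v
    have h2 := hc hv
    simp only [Hle, Hge, Set.mem_preimage, Set.mem_ofPred_eq] at h2 ⊢
    linarith

lemma gen_image (D : RootData n) {g : Equiv.Perm (V n)} (hg : g ∈ AffW D) {v : V n} (hv : Gen D v) :
    Gen D (g v) := by
  intro α hα k h
  obtain ⟨a, ha, m, ht⟩ := trans_pull D hg hα k
  have := ht.1 v
  exact hv a ha m (by linarith)

lemma Cl_image (D : RootData n) {g : Equiv.Perm (V n)} (hg : g ∈ AffW D) (v : V n) :
    g '' Cl D v = Cl D (g v) := by
  apply Set.Subset.antisymm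
  · rintro _ ⟨w, hw, rfl⟩ α hα k hk
    obtain ⟨a, ha, m, ht⟩ := trans_pull D hg hα k
    have h1 := ht.1 v
    have h2 := ht.1 w
    have := hw a ha m (by linarith)
    linarith
  · intro w hw
    refine ⟨g⁻¹ w, ?_, ap_inv _ _⟩
    intro α hα k hk
    obtain ⟨a, ha, m, ht⟩ := trans_ex D hg hα k
    have h1 := ht.1 v
    have h2 := ht.1 (g⁻¹ w)
    rw [ap_inv] at h2
    have := hw a ha m (by linarith)
    linarith

lemma alcove_image (D : RootData n) {g : Equiv.Perm (V n)} (hg : g ∈ AffW D) {c : Set (V n)}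
    (hc : IsAlcove D c) : IsAlcove D (g '' c) := by
  obtain ⟨v, hv, rfl⟩ := (alcove_iff D c).1 hc
  exact (alcove_iff D _).2 ⟨g v, gen_image D hg hv, Cl_image D hg v⟩

/-- `u` lies on exactly one hyperplane. -/
def Pan (D : RootData n) (u : V n) (α : V n) (k : ℤ) : Prop :=
  ⟪α, u⟫ = (k : ℝ) ∧ ∀ β ∈ D.Φ, ∀ m : ℤ, ⟪β, u⟫ = (m : ℝ) → Hy β (m : ℝ) = Hy α (k : ℝ)

lemma Cl_eq_of_same (D : RootData n) {v v' u : V n} {α : V n} {k : ℤ}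
    (hv : Gen D v) (hv' : Gen D v') (hu : u ∈ Cl D v) (hu' : u ∈ Cl D v') (hp : Pan D u α k)
    (hs : ⟪α, v⟫ < (k : ℝ) ∧ ⟪α, v'⟫ < (k : ℝ) ∨ (k : ℝ) < ⟪α, v⟫ ∧ (k : ℝ) < ⟪α, v'⟫) :
    Cl D v = Cl D v' := by
  have key : ∀ β ∈ D.Φ, ∀ m : ℤ, ⟪β, v⟫ < (m : ℝ) ↔ ⟪β, v'⟫ < (m : ℝ) := by
    intro β hβ m
    by_contra hcon
    have hcase : (⟪β, v⟫ < (m : ℝ) ∧ (m : ℝ) < ⟪β, v'⟫) ∨ (⟪β, v'⟫ < (m : ℝ) ∧ (m : ℝ) < ⟪β, v⟫) := by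
      have h1 := lt_or_gt_of_ne (hv β hβ m)
      have h2 := lt_or_gt_of_ne (hv' β hβ m)
      by_cases h3 : ⟪β, v⟫ < (m : ℝ)
      · left; refine ⟨h3, ?_⟩
        rcases h2 with h2 | h2
        · exact absurd (iff_of_true h3 h2) hcon
        · exact h2
      · right
        rcases h1 with h1 | h1
        · exact absurd h1 h3
        rcases h2 with h2 | h2
        · exact ⟨h2, h1⟩
        · exact absurd (iff_of_false h3 (not_lt.2 h2.le)) hcon
    have hum : ⟪β, u⟫ = (m : ℝ) := by
      rcases hcase with ⟨h1, h2⟩ | ⟨h1, h2⟩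
      · exact le_antisymm (hu β hβ m h1) (Cl_ge hu' hβ h2)
      · exact le_antisymm (hu' β hβ m h1) (Cl_ge hu hβ h2)
    have hH := hp.2 β hβ m hum
    set a : ℝ := ⟪β, v⟫ - m with ha
    set b : ℝ := ⟪β, v'⟫ - m with hb
    have hab : a - b ≠ 0 := by
      rcases hcase with ⟨h1, h2⟩ | ⟨h1, h2⟩ <;> intro h <;> linarith
    -- the point of the segment on the hyperplane
    have hz : v + (a / (a - b)) • (v' - v) ∈ Hy β (m : ℝ) := by
      simp only [Hy, Set.mem_ofPred_eq]
      rw [inner_add_right, inner_smul_right, inner_sub_right]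
      have e1 : ⟪β, v⟫ = a + m := by rw [ha]; ring
      have e2 : ⟪β, v'⟫ = b + m := by rw [hb]; ring
      rw [e1, e2]
      field_simp
      ring
    have ht : 0 ≤ a / (a - b) ∧ a / (a - b) ≤ 1 := by
      rcases hcase with ⟨h1, h2⟩ | ⟨h1, h2⟩
      · have : a - b < 0 := by linarith
        constructor
        · exact div_nonneg_of_nonpos (by linarith) this.le
        · rw [div_le_one_of_neg this]; linarith
      · have : 0 < a - b := by linarith
        constructor
        · exact div_nonneg (by linarith) this.le
        · rw [div_le_one this]; linarith
    rw [hH] at hz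
    simp only [Hy, Set.mem_ofPred_eq] at hz
    rw [inner_add_right, inner_smul_right, inner_sub_right] at hz
    generalize a / (a - b) = t at hz ht
    rcases hs with ⟨h1, h2⟩ | ⟨h1, h2⟩
    · rcases eq_or_lt_of_le ht.1 with h | h
      · subst h; linarith
      · nlinarith [ht.2]
    · rcases eq_or_lt_of_le ht.1 with h | h
      · subst h; linarith
      · nlinarith [ht.2]
  ext w
  unfold Cl
  constructor
  · intro h β hβ m hm; exact h β hβ m ((key β hβ m).2 hm)
  · intro h β hβ m hm; exact h β hβ m ((key β hβ m).1 hm)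

/-- Two alcoves sharing a panel point are equal or mirror images. -/
lemma adj (D : RootData n) {c c' : Set (V n)} (hc : IsAlcove D c) (hc' : IsAlcove D c')
    {u α : V n} (hα : α ∈ D.Φ) {k : ℤ} (hp : Pan D u α k) (hu : u ∈ c) (hu' : u ∈ c') :
    c' = c ∨ c' = sP α k '' c := by
  obtain ⟨v, hv, rfl⟩ := (alcove_iff D c).1 hc
  obtain ⟨v', hv', rfl⟩ := (alcove_iff D c').1 hc'
  have h1 := lt_or_gt_of_ne (hv α hα k)
  have h2 := lt_or_gt_of_ne (hv' α hα k)
  by_cases hs : ⟪α, v⟫ < (k : ℝ) ∧ ⟪α, v'⟫ < (k : ℝ) ∨ (k : ℝ) < ⟪α, v⟫ ∧ (k : ℝ) < ⟪α, v'⟫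
  · left; exact (Cl_eq_of_same D hv hv' hu hu' hp hs).symm
  · right
    have hm := sP_mem D hα k
    rw [Cl_image D hm]
    have h3 := inner_sP (D.nonzero α hα) (k : ℝ) v
    refine (Cl_eq_of_same D (gen_image D hm hv) hv' ?_ hu' hp ?_).symm
    · rw [← Cl_image D hm]; exact ⟨u, hu, sP_fix hp.1⟩
    · by_cases h4 : ⟪α, v⟫ < (k : ℝ)
      · right
        refine ⟨by linarith, ?_⟩
        rcases h2 with h2 | h2
        · exact absurd (Or.inl ⟨h4, h2⟩) hs
        · exact h2
      · left
        rcases h1 with h1 | h1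
        · exact absurd h1 h4
        refine ⟨by linarith, ?_⟩
        rcases h2 with h2 | h2
        · exact h2
        · exact absurd (Or.inr ⟨h1, h2⟩) hs

lemma pan_image (D : RootData n) {g : Equiv.Perm (V n)} (hg : g ∈ AffW D) {u α α' : V n} {k k' : ℤ}
    (ht : Trans g α k α' k') (hp : Pan D u α k) : Pan D (g u) α' k' := by
  refine ⟨by have := ht.1 u; have := hp.1; linarith, fun β hβ m hm => ?_⟩
  obtain ⟨b, hb, m', ht'⟩ := trans_pull D hg hβ m
  have h1 := ht'.1 u
  have := hp.2 b hb m' (by linarith)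
  rw [← ht.image_Hy, ← ht'.image_Hy, this]

/-- Extraction of the panel data. -/
lemma panel_data (D : RootData n) {p c : Set (V n)} (h : IsPanelOf D p c) :
    p ⊆ c ∧ ∃ u ∈ p, ∃ α ∈ D.Φ, ∃ k : ℤ, Pan D u α k ∧ p ⊆ Hy α (k : ℝ) := by
  obtain ⟨hc, ⟨u, hu⟩, ⟨H, hH, hp⟩, H', ⟨⟨α, hα, k, rfl⟩, h1⟩, h2⟩ := h
  have hup : u ∈ p := by rw [hu]; exact subset_closure fun _ _ _ => ⟨Iff.rfl, Iff.rfl⟩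
  refine ⟨by rw [hp]; exact Set.inter_subset_left, u, hup, α, hα, k, ⟨h1 hup, ?_⟩, h1⟩
  intro β hβ m hm
  apply h2
  refine ⟨⟨β, hβ, m, rfl⟩, ?_⟩
  rw [hu]
  apply closure_minimal
  · intro w hw; exact (hw β hβ m).1.2 hm
  · exact isClosed_eq (by fun_prop) (by fun_prop)

lemma panel_image (D : RootData n) {g : Equiv.Perm (V n)} (hg : g ∈ AffW D) {p c : Set (V n)}
    (h : IsPanelOf D p c) : IsPanelOf D (g '' p) (g '' c) := by
  obtain ⟨hc, ⟨u, hu⟩, ⟨H, ⟨α, hα, k, rfl⟩, hp⟩, H', ⟨⟨β, hβ, m, rfl⟩, h1⟩, h2⟩ := h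
  refine ⟨alcove_image D hg hc, ⟨g u, ?_⟩, ?_, ?_⟩
  · have himg : ∀ s : Set (V n), g '' closure s = closure (g '' s) := by
      intro s
      let G : V n ≃ₜ V n := { toEquiv := g, continuous_toFun := (cont_of_mem D hg).1, continuous_invFun := (cont_of_mem D hg).2 }
      exact G.image_closure s
    rw [hu, himg]
    congr 1
    ext w
    constructor
    · rintro ⟨x, hx, rfl⟩ a ha b
      obtain ⟨a', ha', b', ht⟩ := trans_pull D hg ha b
      have e1 := ht.1 x
      have e2 := ht.1 u
      obtain ⟨f1, f2⟩ := hx a' ha' b'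
      have g1 : ∀ y, ⟪a, g y⟫ = (b : ℝ) ↔ ⟪a', y⟫ = (b' : ℝ) := fun y => by
        have := ht.1 y; constructor <;> intro <;> linarith
      have g2 : ∀ y, ⟪a, g y⟫ < (b : ℝ) ↔ ⟪a', y⟫ < (b' : ℝ) := fun y => by
        have := ht.1 y; constructor <;> intro <;> linarith
      rw [g1, g1, g2, g2]; exact ⟨f1, f2⟩
    · intro hw
      refine ⟨g⁻¹ w, ?_, ap_inv _ _⟩
      intro a' ha' b'
      obtain ⟨a, ha, b, ht⟩ := trans_ex D hg ha' b'
      have g1 : ∀ y, ⟪a, g y⟫ = (b : ℝ) ↔ ⟪a', y⟫ = (b' : ℝ) := fun y => by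
        have := ht.1 y; constructor <;> intro <;> linarith
      have g2 : ∀ y, ⟪a, g y⟫ < (b : ℝ) ↔ ⟪a', y⟫ < (b' : ℝ) := fun y => by
        have := ht.1 y; constructor <;> intro <;> linarith
      rw [← g1, ← g1, ← g2, ← g2, ap_inv]; exact hw a ha b
  · obtain ⟨a, ha, b, ht⟩ := trans_ex D hg hα k
    refine ⟨_, ⟨a, ha, b, rfl⟩, ?_⟩
    rw [hp, Set.image_inter g.injective, ht.image_Hy]
  · obtain ⟨a, ha, b, ht⟩ := trans_ex D hg hβ m
    refine ⟨_, ⟨⟨a, ha, b, rfl⟩, ?_⟩, ?_⟩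
    · rw [← ht.image_Hy]; exact Set.image_mono h1
    · rintro _ ⟨⟨a2, ha2, b2, rfl⟩, hsub⟩
      obtain ⟨a3, ha3, b3, ht3⟩ := trans_pull D hg ha2 b2
      rw [← ht3.image_Hy, Set.image_subset_image_iff g.injective] at hsub
      rw [← ht3.image_Hy, ← ht.image_Hy, h2 _ ⟨⟨a3, ha3, b3, rfl⟩, hsub⟩]

end Shd

namespace Shd
variable {n : ℕ}

lemma simple_inj (D : RootData n) {v : V n} (h : ∀ i, ⟪D.simple i, v⟫ = (0 : ℝ)) : v = 0 := by
  have hs : Submodule.span ℝ (Set.range D.simple) = ⊤ :=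
    D.simple_indep.span_eq_top_of_card_eq_finrank' (by simp)
  have hv : v ∈ Submodule.span ℝ (Set.range D.simple) := by rw [hs]; trivial
  have : ∀ x ∈ Submodule.span ℝ (Set.range D.simple), ⟪x, v⟫ = (0 : ℝ) := by
    intro x hx
    induction hx using Submodule.span_induction with
    | mem x hx => obtain ⟨i, rfl⟩ := hx; exact h i
    | zero => simp
    | add x y _ _ h1 h2 => rw [inner_add_left, h1, h2, add_zero]
    | smul a x _ h1 => rw [inner_smul_left, h1]; simp
  simpa using this v hv

lemma dual_ex (D : RootData n) (f : Fin n → ℝ) : ∃ v : V n, ∀ i, ⟪D.simple i, v⟫ = f i := by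
  let L : V n →ₗ[ℝ] (Fin n → ℝ) := LinearMap.pi fun i => innerₗ (V n) (D.simple i)
  have hL : Function.Injective L := by
    rw [← LinearMap.ker_eq_bot, LinearMap.ker_eq_bot']
    intro v hv
    exact simple_inj D fun i => congrFun hv i
  have hS : Function.Surjective L :=
    (LinearMap.injective_iff_surjective_of_finrank_eq_finrank (by simp)).1 hL
  obtain ⟨v, hv⟩ := hS f
  exact ⟨v, fun i => congrFun hv i⟩

lemma inner_combo (D : RootData n) (c : Fin n → ℝ) (v : V n) :
    ⟪∑ i, c i • D.simple i, v⟫ = ∑ i, c i * ⟪D.simple i, v⟫ := by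
  rw [sum_inner]; congr 1; ext i; rw [inner_smul_left]; simp

lemma pos_nonneg (D : RootData n) {α v : V n} (hα : α ∈ D.pos) (hv : ∀ i, 0 ≤ ⟪D.simple i, v⟫) :
    0 ≤ ⟪α, v⟫ := by
  obtain ⟨c, hc, rfl⟩ := D.pos_combo α hα
  rw [inner_combo]
  exact Finset.sum_nonneg fun i _ => mul_nonneg (hc i) (hv i)

lemma pos_le_highest (D : RootData n) {α v : V n} (hα : α ∈ D.pos) (hv : ∀ i, 0 ≤ ⟪D.simple i, v⟫) :
    ⟪α, v⟫ ≤ ⟪D.highest, v⟫ := by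
  obtain ⟨c, hc, h⟩ := D.highest_dominates α hα
  have : ⟪D.highest - α, v⟫ = ∑ i, c i * ⟪D.simple i, v⟫ := by rw [h, inner_combo]
  rw [inner_sub_left] at this
  have h2 : 0 ≤ ∑ i, c i * ⟪D.simple i, v⟫ :=
    Finset.sum_nonneg fun i _ => mul_nonneg (hc i) (hv i)
  linarith

lemma pos_pos (D : RootData n) {α v : V n} (hα : α ∈ D.pos) (hv : ∀ i, 0 < ⟪D.simple i, v⟫) :
    0 < ⟪α, v⟫ := by
  have h0 := D.nonzero α (D.pos_sub hα)
  obtain ⟨c, hc, rfl⟩ := D.pos_combo α hα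
  rw [inner_combo]
  have hne : ∃ i, c i ≠ 0 := by
    by_contra hcon
    push Not at hcon
    exact h0 (by simp [hcon])
  obtain ⟨i, hi⟩ := hne
  exact Finset.sum_pos' (fun i _ => mul_nonneg (hc i) (hv i).le)
    ⟨i, Finset.mem_univ _, mul_pos (lt_of_le_of_ne (hc i) hi.symm) (hv i)⟩

/-- The walls of the fundamental alcove, with outward orientation. -/
def Wall (D : RootData n) (β : V n) (b : ℤ) : Prop :=
  (∃ i, β = -D.simple i ∧ b = 0) ∨ (β = D.highest ∧ b = 1)

lemma wall_mem (D : RootData n) {β : V n} {b : ℤ} (h : Wall D β b) : β ∈ D.Φ := by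
  rcases h with ⟨i, rfl, _⟩ | ⟨rfl, _⟩
  · exact D.neg_mem _ (D.pos_sub (D.simple_mem i))
  · exact D.pos_sub D.highest_mem

lemma mem_fund_iff (D : RootData n) (v : V n) :
    v ∈ fund D ↔ ∀ β b, Wall D β b → ⟪β, v⟫ ≤ (b : ℝ) := by
  constructor
  · rintro ⟨h1, h2⟩ β b (⟨i, rfl, rfl⟩ | ⟨rfl, rfl⟩)
    · simpa [inner_neg_left] using h1 i
    · simpa using h2
  · intro h
    refine ⟨fun i => ?_, ?_⟩
    · have := h _ _ (Or.inl ⟨i, rfl, rfl⟩)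
      simpa [inner_neg_left] using this
    · simpa using h _ _ (Or.inr ⟨rfl, rfl⟩)

lemma fund_sub (D : RootData n) {β : V n} {b : ℤ} (h : Wall D β b) : fund D ⊆ Hle β b :=
  fun v hv => (mem_fund_iff D v).1 hv β b h

lemma scaled_ex (D : RootData n) (f : Fin n → ℝ) (hf : ∀ i, 0 ≤ f i) :
    ∃ u : V n, ∃ e : ℝ, 0 < e ∧ (∀ i, ⟪D.simple i, u⟫ = e * f i) ∧ ⟪D.highest, u⟫ < 1 := by
  obtain ⟨v, hv⟩ := dual_ex D f
  have hs : 0 ≤ ⟪D.highest, v⟫ := pos_nonneg D D.highest_mem fun i => by rw [hv]; exact hf i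
  refine ⟨(1 / (⟪D.highest, v⟫ + 1)) • v, 1 / (⟪D.highest, v⟫ + 1), by positivity, ?_, ?_⟩
  · intro i; rw [inner_smul_right, hv]
  · rw [inner_smul_right, one_div, inv_mul_lt_iff₀ (by positivity)]; linarith

lemma Hy_neg (α : V n) (k : ℤ) : Hy (-α) ((-k : ℤ) : ℝ) = Hy α k := by
  ext v; simp [Hy, inner_neg_left]

lemma pan_of_pos (D : RootData n) {u α : V n} {k : ℤ} (h0 : ⟪α, u⟫ = (k : ℝ))
    (h : ∀ β ∈ D.pos, ∀ m : ℤ, ⟪β, u⟫ = (m : ℝ) → Hy β (m : ℝ) = Hy α (k : ℝ)) : Pan D u α k := by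
  refine ⟨h0, fun β hβ m hm => ?_⟩
  rcases D.pos_total β hβ with hp | hp
  · exact h β hp m hm
  · rw [← Hy_neg]
    exact h _ hp (-m) (by rw [inner_neg_left, hm]; push_cast; ring)

lemma wall_pan (D : RootData n) {β : V n} {b : ℤ} (h : Wall D β b) :
    ∃ u ∈ fund D, Pan D u β b := by
  rcases h with ⟨i, rfl, rfl⟩ | ⟨rfl, rfl⟩
  · obtain ⟨u, e, he, hu, hu1⟩ := scaled_ex D (fun j => if j = i then 0 else 1)
      (fun j => by split_ifs <;> norm_num)
    have hnn : ∀ j, 0 ≤ ⟪D.simple j, u⟫ := fun j => by rw [hu]; split_ifs <;> simp [he.le]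
    refine ⟨u, ⟨hnn, hu1.le⟩, ?_⟩
    refine pan_of_pos D (by rw [inner_neg_left, hu]; simp) fun α hα m hm => ?_
    have h1 := pos_nonneg D hα hnn
    have h2 := pos_le_highest D hα hnn
    have hm0 : m = 0 := by
      have a1 : (0 : ℝ) ≤ m := by linarith
      have a2 : (m : ℝ) < 1 := by linarith
      have a1 : 0 ≤ m := by exact_mod_cast a1
      have a2 : m < 1 := by exact_mod_cast a2
      omega
    subst hm0
    obtain ⟨c, hc, hcα⟩ := D.pos_combo α hα
    have hsum : ∑ j, c j * ⟪D.simple j, u⟫ = 0 := by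
      rw [← inner_combo, ← hcα, hm]; simp
    have hz := (Finset.sum_eq_zero_iff_of_nonneg (fun j _ => mul_nonneg (hc j) (hnn j))).1 hsum
    have hci : ∀ j, j ≠ i → c j = 0 := by
      intro j hj
      have := hz j (Finset.mem_univ _)
      rw [hu] at this
      simp [hj, he.ne'] at this
      exact this
    have hα2 : α = c i • D.simple i := by
      rw [hcα, Finset.sum_eq_single i]
      · intro j _ hj; rw [hci j hj, zero_smul]
      · intro h; exact absurd (Finset.mem_univ _) h
    have hmem := D.pos_sub hα
    rcases D.reduced _ (D.pos_sub (D.simple_mem i)) (c i) (hα2 ▸ hmem) with hh | hh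
    · rw [hh, one_smul] at hα2
      rw [hα2, ← Hy_neg]; simp
    · rw [hh, neg_smul, one_smul] at hα2
      rw [hα2]
  · obtain ⟨v, hv⟩ := dual_ex D (fun _ => 1)
    have hs : 0 < ⟪D.highest, v⟫ := pos_pos D D.highest_mem fun i => by rw [hv]; norm_num
    have hu : ∀ j, 0 < ⟪D.simple j, (1 / ⟪D.highest, v⟫ : ℝ) • v⟫ := fun j => by
      rw [inner_smul_right, hv]; positivity
    have hu1 : ⟪D.highest, (1 / ⟪D.highest, v⟫ : ℝ) • v⟫ = (1 : ℝ) := by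
      rw [inner_smul_right]; field_simp
    generalize (1 / ⟪D.highest, v⟫ : ℝ) • v = u at hu hu1
    refine ⟨u, ⟨fun j => (hu j).le, hu1.le⟩, ?_⟩
    refine pan_of_pos D (by rw [hu1]; simp) fun α hα m hm => ?_
    have h1 := pos_pos D hα hu
    have h2 := pos_le_highest D hα fun j => (hu j).le
    have hm0 : m = 1 := by
      have a1 : (0 : ℝ) < m := by linarith
      have a2 : (m : ℝ) ≤ 1 := by linarith
      have a1 : 0 < m := by exact_mod_cast a1
      have a2 : m ≤ 1 := by exact_mod_cast a2
      omega
    subst hm0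
    obtain ⟨c, hc, hcα⟩ := D.highest_dominates α hα
    have hsum : ∑ j, c j * ⟪D.simple j, u⟫ = 0 := by
      rw [← inner_combo, ← hcα, inner_sub_left, hm, hu1]; simp
    have hz := (Finset.sum_eq_zero_iff_of_nonneg (fun j _ => mul_nonneg (hc j) (hu j).le)).1 hsum
    have hci : ∀ j, c j = 0 := by
      intro j
      have := hz j (Finset.mem_univ _)
      rcases mul_eq_zero.1 this with h | h
      · exact h
      · exact absurd h (hu j).ne'
    have : D.highest - α = 0 := by rw [hcα]; simp [hci]
    rw [sub_eq_zero.1 this]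

lemma fund_eq_Cl (D : RootData n) {v : V n} (hv : Gen D v) (hf : v ∈ fund D) : Cl D v = fund D := by
  ext w
  constructor
  · intro hw
    refine ⟨fun i => ?_, ?_⟩
    · have hi := D.pos_sub (D.simple_mem i)
      have h1 := hv _ hi 0
      have h2 : ((0 : ℤ) : ℝ) < ⟪D.simple i, v⟫ := lt_of_le_of_ne (by simpa using hf.1 i) h1.symm
      simpa using Cl_ge hw hi h2
    · have hi := D.pos_sub D.highest_mem
      have h2 : ⟪D.highest, v⟫ < ((1 : ℤ) : ℝ) := lt_of_le_of_ne (by simpa using hf.2) (hv _ hi 1)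
      simpa using hw _ hi 1 h2
  · intro hw α hα k hk
    rcases D.pos_total α hα with hp | hp
    · have h1 := pos_nonneg D hp hf.1
      have h2 := pos_le_highest D hp hw.1
      have h3 := hw.2
      have : (0 : ℝ) < k := by linarith
      have : 0 < k := by exact_mod_cast this
      have : (1 : ℝ) ≤ k := by exact_mod_cast this
      linarith
    · have h1 := pos_nonneg D hp hw.1
      have h2 := pos_le_highest D hp hf.1
      have h3 := hf.2
      rw [inner_neg_left] at h1 h2
      have : (-1 : ℝ) < k := by linarith
      have : -1 < k := by exact_mod_cast this
      have : 0 ≤ k := by omega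
      have : (0 : ℝ) ≤ k := by exact_mod_cast this
      linarith

lemma interior_gen (D : RootData n) {v : V n} (hv : ∀ β b, Wall D β b → ⟪β, v⟫ < (b : ℝ)) :
    Gen D v := by
  have h1 : ∀ i, 0 < ⟪D.simple i, v⟫ := fun i => by
    have := hv _ _ (Or.inl ⟨i, rfl, rfl⟩)
    simpa [inner_neg_left] using this
  have h2 : ⟪D.highest, v⟫ < 1 := by simpa using hv _ _ (Or.inr ⟨rfl, rfl⟩)
  have key : ∀ α ∈ D.pos, ∀ k : ℤ, ⟪α, v⟫ ≠ (k : ℝ) := by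
    intro α hα k hk
    have h3 := pos_pos D hα h1
    have h4 := pos_le_highest D hα fun i => (h1 i).le
    have a1 : (0 : ℝ) < k := by linarith
    have a2 : (k : ℝ) < 1 := by linarith
    have a1 : 0 < k := by exact_mod_cast a1
    have a2 : k < 1 := by exact_mod_cast a2
    omega
  intro α hα k hk
  rcases D.pos_total α hα with hp | hp
  · exact key α hp k hk
  · exact key _ hp (-k) (by rw [inner_neg_left, hk]; push_cast; ring)

lemma interior_ex (D : RootData n) : ∃ v : V n, ∀ β b, Wall D β b → ⟪β, v⟫ < (b : ℝ) := by
  obtain ⟨u, e, he, hu, hu1⟩ := scaled_ex D (fun _ => 1) (fun _ => by norm_num)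
  refine ⟨u, ?_⟩
  rintro β b (⟨i, rfl, rfl⟩ | ⟨rfl, rfl⟩)
  · rw [inner_neg_left, hu]; simpa using he
  · simpa using hu1

lemma fund_alcove (D : RootData n) : IsAlcove D (fund D) := by
  obtain ⟨v, hv⟩ := interior_ex D
  have hg := interior_gen D hv
  exact (alcove_iff D _).2 ⟨v, hg, (fund_eq_Cl D hg ((mem_fund_iff D v).2 fun β b h => (hv β b h).le)).symm⟩

/-- The group generated by the wall reflections. -/
def WS (D : RootData n) : Subgroup (Equiv.Perm (V n)) :=
  Subgroup.closure {e | ∃ β b, Wall D β b ∧ e = sP β (b : ℝ)}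

lemma WS_le (D : RootData n) : WS D ≤ AffW D := by
  unfold WS
  rw [Subgroup.closure_le]
  rintro _ ⟨β, b, h, rfl⟩
  exact sP_mem D (wall_mem D h) b

lemma sP_mem_WS (D : RootData n) {β : V n} {b : ℤ} (h : Wall D β b) : sP β (b : ℝ) ∈ WS D :=
  Subgroup.subset_closure ⟨β, b, h, rfl⟩

lemma orbit_finite (D : RootData n) (v v0 : V n) (R : ℝ) :
    {x : V n | (∃ g ∈ AffW D, x = g v) ∧ ‖v0 - x‖ ≤ R}.Finite := by
  let F : V n → (Fin n → ℝ) := fun x i => ⟪D.simple i, x⟫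
  have hF : Function.Injective F := by
    intro x y h
    have : x - y = 0 := simple_inj D fun i => by
      rw [inner_sub_right, sub_eq_zero]; exact congrFun h i
    exact sub_eq_zero.1 this
  apply Set.Finite.of_finite_image _ hF.injOn
  let B : Fin n → ℝ := fun i => ‖D.simple i‖ * (‖v0‖ + R)
  let T : Fin n → Set ℝ := fun i =>
    ⋃ β ∈ D.Φ, (fun m : ℤ => ⟪β, v⟫ + (m : ℝ)) ''
      Set.Icc ⌊-(B i) - ⟪β, v⟫⌋ ⌈B i - ⟪β, v⟫⌉
  have hT : (Set.univ.pi T).Finite := by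
    exact Set.Finite.pi fun i => D.finite.biUnion fun β _ => (Set.finite_Icc _ _).image _
  refine hT.subset ?_
  rintro _ ⟨x, ⟨⟨g, hg, hx⟩, hR⟩, rfl⟩ i -
  obtain ⟨β, hβ, m, ht⟩ := trans_pull D hg (D.pos_sub (D.simple_mem i)) 0
  simp only [T, Set.mem_iUnion]
  refine ⟨β, hβ, -m, ?_, ?_⟩
  · have h1 := ht.1 v
    rw [← hx] at h1
    have h2 : |⟪D.simple i, x⟫| ≤ B i := by
      refine (abs_real_inner_le_norm _ _).trans ?_
      apply mul_le_mul_of_nonneg_left _ (norm_nonneg _)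
      have : x = v0 - (v0 - x) := by abel
      calc ‖x‖ = ‖v0 - (v0 - x)‖ := by rw [← this]
        _ ≤ ‖v0‖ + ‖v0 - x‖ := norm_sub_le _ _
        _ ≤ _ := by linarith
    rw [abs_le] at h2
    push_cast at h1
    constructor
    · have : (⌊-(B i) - ⟪β, v⟫⌋ : ℝ) ≤ ((-m : ℤ) : ℝ) :=
        (Int.floor_le _).trans (by push_cast; linarith)
      exact_mod_cast this
    · have : ((-m : ℤ) : ℝ) ≤ (⌈B i - ⟪β, v⟫⌉ : ℝ) :=
        le_trans (by push_cast; linarith) (Int.le_ceil _)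
      exact_mod_cast this
  · have h1 := ht.1 v
    rw [← hx] at h1
    push_cast at h1
    simp only [F]
    push_cast
    linarith

lemma sP_closer {β x v0 : V n} {b : ℝ} (hβ : β ≠ 0) (h1 : b < ⟪β, x⟫) (h0 : ⟪β, v0⟫ < b) :
    ‖v0 - sP β b x‖ < ‖v0 - x‖ := by
  have hb : 0 < ⟪β, β⟫ := real_inner_self_pos.2 hβ
  have : ‖v0 - sP β b x‖ ^ 2 < ‖v0 - x‖ ^ 2 := by
    rw [sP_apply]
    have e : v0 - (x - (⟪β, x⟫ - b) • coroot β) = (v0 - x) + ((⟪β, x⟫ - b) * (2 / ⟪β, β⟫)) • β := by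
      unfold coroot; module
    rw [e, norm_add_sq_real, inner_smul_right, norm_smul, mul_pow, ← real_inner_self_eq_norm_sq β]
    rw [real_inner_comm β (v0 - x), inner_sub_right]
    have e2 : ‖(⟪β, x⟫ - b) * (2 / ⟪β, β⟫)‖ ^ 2 * ⟪β, β⟫ = 4 * (⟪β, x⟫ - b) ^ 2 / ⟪β, β⟫ := by
      rw [Real.norm_eq_abs, sq_abs]; field_simp; ring
    rw [e2]
    have e3 : 2 * ((⟪β, x⟫ - b) * (2 / ⟪β, β⟫) * (⟪β, v0⟫ - ⟪β, x⟫)) + 4 * (⟪β, x⟫ - b) ^ 2 / ⟪β, β⟫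
        = -(4 * ((⟪β, x⟫ - b) * (b - ⟪β, v0⟫)) / ⟪β, β⟫) := by
      field_simp; ring
    have e4 : 0 < 4 * ((⟪β, x⟫ - b) * (b - ⟪β, v0⟫)) / ⟪β, β⟫ := by
      apply div_pos _ hb
      have := mul_pos (sub_pos.2 h1) (sub_pos.2 h0)
      linarith
    linarith
  exact lt_of_pow_lt_pow_left₀ 2 (norm_nonneg _) this

/-- Every point can be moved to the fundamental alcove by wall reflections. -/
lemma to_fund (D : RootData n) (v : V n) : ∃ g ∈ WS D, g v ∈ fund D := by
  obtain ⟨v0, hv0⟩ := interior_ex D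
  set X := {x : V n | (∃ g ∈ WS D, x = g v) ∧ ‖v0 - x‖ ≤ ‖v0 - v‖}
  have hX : X.Finite := (orbit_finite D v v0 ‖v0 - v‖).subset fun x hx =>
    ⟨hx.1.imp fun g h => ⟨WS_le D h.1, h.2⟩, hx.2⟩
  obtain ⟨x, ⟨⟨g, hg, hx⟩, hxR⟩, hmin⟩ := Set.exists_min_image X (fun x => ‖v0 - x‖) hX
    ⟨v, ⟨1, one_mem _, rfl⟩, le_rfl⟩
  refine ⟨g, hg, ?_⟩
  rw [← hx, mem_fund_iff]
  by_contra hcon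
  push Not at hcon
  obtain ⟨β, b, hw, hlt⟩ := hcon
  have hc := sP_closer (D.nonzero β (wall_mem D hw)) hlt (hv0 β b hw)
  have := hmin (sP β b x) ⟨⟨sP β b * g, mul_mem (sP_mem_WS D hw) hg, by
    rw [hx]; rfl⟩, hc.le.trans hxR⟩
  exact absurd hc (not_lt.2 this)

lemma pan_ex (D : RootData n) {α : V n} (hα : α ∈ D.Φ) (k : ℤ) : ∃ u, Pan D u α k := by
  have ha : ⟪α, α⟫ ≠ (0 : ℝ) := by simpa using D.nonzero α hα
  let pr : V n → V n := fun β => β - (⟪α, β⟫ / ⟪α, α⟫) • α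
  have := D.finite.to_subtype
  let ι := {β : D.Φ // pr β ≠ 0}
  obtain ⟨f, hf⟩ := Module.exists_dual_forall_apply_ne_zero (K := ℝ) (fun β : ι => pr β.1) (fun β => β.2)
  obtain ⟨h1, hh1⟩ : ∃ h1 : V n, ∀ x, f x = ⟪h1, x⟫ := by
    refine ⟨(InnerProductSpace.toDual ℝ (V n)).symm (LinearMap.toContinuousLinearMap f), fun x => ?_⟩
    rw [InnerProductSpace.toDual_symm_apply]; rfl
  have hpr : ∀ β, ⟪β, pr h1⟫ = ⟪h1, pr β⟫ := by
    intro β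
    simp only [pr, inner_sub_right, inner_smul_right]
    rw [real_inner_comm h1 β, real_inner_comm β α, real_inner_comm h1 α]
    ring
  obtain ⟨a0, h0⟩ : ∃ a0 : V n, ⟪α, a0⟫ = (k : ℝ) :=
    ⟨((k : ℝ) / ⟪α, α⟫) • α, by rw [inner_smul_right]; field_simp⟩
  have hprα : ⟪α, pr h1⟫ = (0 : ℝ) := by
    simp only [pr, inner_sub_right, inner_smul_right]; field_simp; ring
  have hcount : (⋃ β : ι, Set.range fun m : ℤ => ((m : ℝ) - ⟪β.1.1, a0⟫) / ⟪β.1.1, pr h1⟫).Countable :=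
    Set.countable_iUnion fun β => Set.countable_range _
  obtain ⟨t, ht⟩ := (hcount.dense_compl ℝ).nonempty
  refine ⟨a0 + t • pr h1, ?_, ?_⟩
  · rw [inner_add_right, inner_smul_right, h0, hprα]; ring
  · intro β hβ m hm
    by_cases hz : pr β = 0
    · have h6 : β = (⟪α, β⟫ / ⟪α, α⟫ : ℝ) • α := sub_eq_zero.mp hz
      rcases D.reduced α hα (⟪α, β⟫ / ⟪α, α⟫ : ℝ) (h6 ▸ hβ) with hc | hc
      · rw [hc, one_smul] at h6
        subst h6
        rw [inner_add_right, inner_smul_right, h0, hprα] at hm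
        have : (m : ℝ) = k := by linarith
        rw [this]
      · rw [hc, neg_smul, one_smul] at h6
        subst h6
        rw [inner_neg_left, inner_add_right, inner_smul_right, h0, hprα] at hm
        have : (m : ℝ) = ((-k : ℤ) : ℝ) := by push_cast; linarith
        rw [this, Hy_neg]
    · exfalso
      apply ht
      rw [Set.mem_iUnion]
      refine ⟨⟨⟨β, hβ⟩, hz⟩, m, ?_⟩
      have hne : ⟪β, pr h1⟫ ≠ (0 : ℝ) := by
        rw [hpr, ← hh1]; exact hf ⟨⟨β, hβ⟩, hz⟩
      rw [inner_add_right, inner_smul_right] at hm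
      simp only
      field_simp
      linarith

lemma AffW_le_WS (D : RootData n) : AffW D ≤ WS D := by
  unfold AffW
  rw [Subgroup.closure_le]
  rintro e ⟨α, hα, k, he⟩
  have : e = sP α k := by ext1 v; rw [he]; rfl
  subst this
  obtain ⟨u, hu⟩ := pan_ex D hα k
  obtain ⟨g, hg, hgu⟩ := to_fund D u
  obtain ⟨a, ha, m, ht⟩ := trans_ex D (WS_le D hg) hα k
  have hp := pan_image D (WS_le D hg) ht hu
  have : ∃ β b, Wall D β b ∧ ⟪β, g u⟫ = (b : ℝ) := by
    by_contra hcon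
    push Not at hcon
    exact interior_gen D (fun β b h => lt_of_le_of_ne ((mem_fund_iff D _).1 hgu β b h) (hcon β b h))
      a ha m hp.1
  obtain ⟨β, b, hw, hb⟩ := this
  have h1 := Hy_eq_sP D ha (wall_mem D hw) (hp.2 β (wall_mem D hw) b hb).symm
  have h2 : sP α k = g⁻¹ * sP β b * g := by rw [h1, ← ht.2]; group
  change sP α k ∈ WS D
  rw [h2]
  exact mul_mem (mul_mem (inv_mem hg) (sP_mem_WS D hw)) hg

end Shd

namespace Shd
variable {n : ℕ}

/-- Words in the wall reflections of the fundamental alcove. -/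
inductive Wd (D : RootData n) : ℕ → Equiv.Perm (V n) → Prop
  | nil : Wd D 0 1
  | cons {m : ℕ} {y : Equiv.Perm (V n)} {β : V n} {b : ℤ} (hw : Wall D β b) (h : Wd D m y) :
      Wd D (m + 1) (sP β (b : ℝ) * y)

lemma Wd.mem {D : RootData n} {m : ℕ} {y : Equiv.Perm (V n)} (h : Wd D m y) : y ∈ AffW D := by
  induction h with
  | nil => exact one_mem _
  | cons hw h ih => exact mul_mem (sP_mem D (wall_mem D hw) _) ih

lemma Wd.mul {D : RootData n} {m m' : ℕ} {y z : Equiv.Perm (V n)} (h : Wd D m y) (h' : Wd D m' z) :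
    ∃ k, Wd D k (y * z) := by
  induction h with
  | nil => exact ⟨m', by simpa using h'⟩
  | cons hw h ih =>
    obtain ⟨k, hk⟩ := ih
    exact ⟨k + 1, by rw [mul_assoc]; exact Wd.cons hw hk⟩

lemma Wd.inv {D : RootData n} {m : ℕ} {y : Equiv.Perm (V n)} (h : Wd D m y) :
    ∃ k, Wd D k y⁻¹ := by
  induction h with
  | nil => exact ⟨0, by rw [inv_one]; exact Wd.nil⟩
  | cons hw h ih =>
    obtain ⟨k, hk⟩ := ih
    rw [mul_inv_rev, sP_inv]
    have h1 := Wd.cons hw Wd.nil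
    rw [mul_one] at h1
    exact hk.mul h1

lemma wd_ex (D : RootData n) {y : Equiv.Perm (V n)} (h : y ∈ AffW D) : ∃ m, Wd D m y := by
  have h' := AffW_le_WS D h
  unfold WS at h'
  induction h' using Subgroup.closure_induction with
  | mem x hx =>
    obtain ⟨β, b, hw, rfl⟩ := hx
    have h1 := Wd.cons hw Wd.nil
    rw [mul_one] at h1
    exact ⟨_, h1⟩
  | one => exact ⟨0, Wd.nil⟩
  | mul x y hx hy ihx ihy =>
    obtain ⟨a, ha⟩ := ihx (WS_le D hx)
    obtain ⟨b, hb⟩ := ihy (WS_le D hy)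
    exact ha.mul hb
  | inv x hx ih =>
    obtain ⟨a, ha⟩ := ih (WS_le D hx)
    exact ha.inv

lemma wd_exchange (D : RootData n) {m : ℕ} {y : Equiv.Perm (V n)} (h : Wd D m y) :
    ∀ {α : V n} {k : ℤ}, α ∈ D.Φ → fund D ⊆ Hle α k → y '' fund D ⊆ Hge α k →
      ∃ m', m' < m ∧ Wd D m' (sP α k * y) := by
  induction h with
  | nil =>
    intro α k hα h1 h2
    exfalso
    apply not_both D (fund_alcove D) hα h1
    simpa using h2
  | @cons m y β b hw h ih =>
    intro α k hα h1 h2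
    have ht := sP_mem D (wall_mem D hw) b
    obtain ⟨a, ha, j, tr⟩ := trans_pull D ht hα k
    rw [Equiv.Perm.coe_mul, Set.image_comp, tr.image_Hge] at h2
    rcases side D (fund_alcove D) ha j with h3 | h3
    · obtain ⟨m', hm', hW⟩ := ih ha h3 h2
      refine ⟨m' + 1, by omega, ?_⟩
      have : sP α k * (sP β b * y) = sP β b * (sP a j * y) := by
        rw [← tr.2]; group
      rw [this]
      exact Wd.cons hw hW
    · refine ⟨m, by omega, ?_⟩
      obtain ⟨u, hu, hp⟩ := wall_pan D hw
      have h4 := (tr.image_Hge (fund D)).2 h3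
      have h5 : u ∈ Hge α k := h4 ⟨u, hu, sP_fix hp.1⟩
      have h6 : ⟪α, u⟫ = (k : ℝ) := le_antisymm (h1 hu) h5
      have h7 := Hy_eq_sP D hα (wall_mem D hw) (hp.2 α hα k h6)
      rw [h7, ← mul_assoc, sP_mul_self, one_mul]
      exact h

lemma strict_fund (D : RootData n) : ∀ (m : ℕ) (y : Equiv.Perm (V n)), Wd D m y →
    ∀ v ∈ fund D, y v ∈ fund D → y v = v := by
  intro m
  induction m using Nat.strong_induction_on with
  | _ m IH =>
  intro y hy v hv hyv
  cases hy with
  | nil => rfl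
  | @cons m' y' β b hw h =>
    rcases side D (alcove_image D h.mem (fund_alcove D)) (wall_mem D hw) b with h1 | h1
    · have h2 : (sP β b) (y' v) ∈ Hge β b :=
        (sP_swap D (wall_mem D hw) b _).2.2 h1 ⟨_, ⟨v, hv, rfl⟩, rfl⟩
      have h3 : ⟪β, sP β b (y' v)⟫ = (b : ℝ) := le_antisymm (fund_sub D hw hyv) h2
      have h4 : sP β b (y' v) = y' v := by
        have := sP_fix h3
        rw [sP_sP] at this
        exact this.symm
      have h5 : (sP β b * y') v = y' v := h4
      rw [h5]
      rw [h5] at hyv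
      exact IH m' (by omega) y' h v hv hyv
    · obtain ⟨m'', hm, hW⟩ := wd_exchange D h (wall_mem D hw) (fund_sub D hw) h1
      exact IH m'' (by omega) _ hW v hv hyv

lemma alcove_trans (D : RootData n) {c : Set (V n)} (hc : IsAlcove D c) :
    ∃ g ∈ AffW D, c = g '' fund D := by
  obtain ⟨v, hv, rfl⟩ := (alcove_iff D c).1 hc
  obtain ⟨g, hg, hgv⟩ := to_fund D v
  have hg := WS_le D hg
  have h1 : Cl D (g v) = fund D := fund_eq_Cl D (gen_image D hg hv) hgv
  refine ⟨g⁻¹, inv_mem hg, ?_⟩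
  rw [← h1, Cl_image D (inv_mem hg), inv_ap]

lemma strict (D : RootData n) {c : Set (V n)} (hc : IsAlcove D c) {g : Equiv.Perm (V n)}
    (hg : g ∈ AffW D) {v : V n} (hv : v ∈ c) (hgv : g v ∈ c) : g v = v := by
  obtain ⟨h, hh, rfl⟩ := alcove_trans D hc
  obtain ⟨w, hw, rfl⟩ := hv
  obtain ⟨w', hw', e⟩ := hgv
  obtain ⟨m, hm⟩ := wd_ex D (mul_mem (mul_mem (inv_mem hh) hg) hh)
  have e1 : (h⁻¹ * g * h) w = w' := by
    change h⁻¹ (g (h w)) = w'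
    rw [← e, inv_ap]
  have := strict_fund D m _ hm w hw (by rw [e1]; exact hw')
  rw [e1] at this
  rw [← e, this]

lemma strict_set (D : RootData n) {c : Set (V n)} (hc : IsAlcove D c) {g : Equiv.Perm (V n)}
    (hg : g ∈ AffW D) {p : Set (V n)} (hp : p ⊆ c) (hgp : g '' p ⊆ c) : g '' p = p := by
  have : ∀ v ∈ p, g v = v := fun v hv => strict D hc hg (hp hv) (hgp ⟨v, hv, rfl⟩)
  ext x
  constructor
  · rintro ⟨v, hv, rfl⟩; rw [this v hv]; exact hv
  · intro hx; exact ⟨x, hx, this x hx⟩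

end Shd

namespace Shd
variable {n : ℕ}

lemma Pan.change {D : RootData n} {u a α : V n} {j k : ℤ} (h : Pan D u a j) (hα : α ∈ D.Φ)
    (he : ⟪α, u⟫ = (k : ℝ)) : Pan D u α k :=
  ⟨he, fun β hβ m hm => (h.2 β hβ m hm).trans (h.2 α hα k he).symm⟩

lemma sP_image_image (α : V n) (k : ℝ) (c : Set (V n)) : sP α k '' (sP α k '' c) = c := by
  rw [← Set.image_comp, ← Equiv.Perm.coe_mul, sP_mul_self]; simp

/-- Galleries starting at the origin, of given length and given last alcove. -/
inductive G (D : RootData n) : ℕ → Set (V n) → Prop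
  | base {c : Set (V n)} (hc : IsAlcove D c) (h0 : (0 : V n) ∈ c) : G D 0 c
  | step {m : ℕ} {c c' p : Set (V n)} (h : G D m c) (hp : IsPanelOf D p c)
      (hp' : IsPanelOf D p c') : G D (m + 1) c'

lemma G_refl (D : RootData n) {m : ℕ} {c : Set (V n)} (h : G D m c) :
    ∀ {α : V n} {k : ℤ}, α ∈ D.Φ → c ⊆ Hle α k → k < 0 →
      ∃ m', m = m' + 1 ∧ G D m' (sP α k '' c) := by
  induction h with
  | base hc h0 =>
    intro α k hα h1 hk
    exfalso
    have := h1 h0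
    simp only [Hle, Set.mem_ofPred_eq, inner_zero_right] at this
    have : 0 ≤ k := by exact_mod_cast this
    omega
  | @step m c c' p h hp hp' ih =>
    intro α k hα h1 hk
    refine ⟨m, rfl, ?_⟩
    rcases side D hp.1 hα k with h2 | h2
    · obtain ⟨m', rfl, h3⟩ := ih hα h2 hk
      exact G.step h3 (panel_image D (sP_mem D hα k) hp) (panel_image D (sP_mem D hα k) hp')
    · obtain ⟨hpc, u, hu, a, ha, j, hpan, -⟩ := panel_data D hp
      obtain ⟨hpc', -⟩ := panel_data D hp'
      have he : ⟪α, u⟫ = (k : ℝ) := le_antisymm (h1 (hpc' hu)) (h2 (hpc hu))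
      rcases adj D hp.1 hp'.1 hα (hpan.change hα he) (hpc hu) (hpc' hu) with h3 | h3
      · subst h3; exact (not_both D hp.1 hα h1 h2).elim
      · rw [h3, sP_image_image]; exact h

lemma G_gallery (D : RootData n) {m : ℕ} {c : Set (V n)} (h : G D m c) :
    ∃ (P C : ℕ → Set (V n)), (∀ i ≤ m, IsAlcove D (C i)) ∧ P 0 = {0} ∧ (0 : V n) ∈ C 0 ∧
      (∀ i, 1 ≤ i → i ≤ m → IsPanelOf D (P i) (C (i - 1)) ∧ IsPanelOf D (P i) (C i)) ∧ C m = c := by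
  induction h with
  | @base c hc h0 =>
    exact ⟨fun _ => {0}, fun _ => c, fun _ _ => hc, rfl, h0, fun i h1 h2 => by omega, rfl⟩
  | @step m c c' p h hp hp' ih =>
    obtain ⟨P, C, h1, h2, h3, h4, h5⟩ := ih
    refine ⟨fun i => if i = m + 1 then p else P i, fun i => if i = m + 1 then c' else C i,
      ?_, ?_, ?_, ?_, ?_⟩
    · intro i hi
      by_cases e : i = m + 1
      · simp only [e, if_true]; exact hp'.1
      · simp only [e, if_false]; exact h1 i (by omega)
    · simpa using h2
    · simpa using h3
    · intro i hi hi'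
      by_cases e : i = m + 1
      · subst e
        simp [h5, hp, hp']
      · have e' : i - 1 ≠ m + 1 := by omega
        simp only [e, e', if_false]
        exact h4 i hi (by omega)
    · simp

lemma min_le (D : RootData n) {γ : PreGallery n} (hmin : IsMinimal D γ) {lam : V n}
    (hfirst : γ.p 0 = {(0 : V n)}) (hlast : γ.p (γ.len + 1) = {lam}) {m : ℕ}
    (h : G D m (γ.c γ.len)) : γ.len ≤ m := by
  obtain ⟨P, C, h1, h2, h3, h4, h5⟩ := G_gallery D h
  have hg := hmin.1
  have := hmin.2 ⟨m, fun i => if i = m + 1 then {lam} else P i, C⟩ ?_ ?_ ?_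
  · exact this
  · refine ⟨h1, ⟨?_, ?_⟩, ⟨?_, ?_⟩, ?_⟩
    · simp only [show (0 : ℕ) ≠ m + 1 by omega, if_false]
      rw [h2, ← hfirst]; exact hg.2.1.1
    · simp only [show (0 : ℕ) ≠ m + 1 by omega, if_false]
      rw [h2]; simpa using h3
    · simp only [if_true]
      rw [← hlast]; exact hg.2.2.1.1
    · simp only [if_true]
      rw [h5, ← hlast]; exact hg.2.2.1.2
    · intro i hi hi'
      simp only at hi'
      simp only [show i ≠ m + 1 by omega, if_false]
      exact h4 i hi hi'
  · simp only [show (0 : ℕ) ≠ m + 1 by omega, if_false]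
    rw [h2, hfirst]
  · simp only [if_true]
    rw [hlast]

lemma G_initial (D : RootData n) {γ : PreGallery n} (hg : IsGallery D γ)
    (hfirst : γ.p 0 = {(0 : V n)}) : ∀ i ≤ γ.len, G D i (γ.c i) := by
  intro i
  induction i with
  | zero =>
    intro _
    refine G.base (hg.1 0 (by omega)) (hg.2.1.2 ?_)
    rw [hfirst]; rfl
  | succ i ih =>
    intro hi
    have := hg.2.2.2 (i + 1) (by omega) hi
    exact G.step (ih (by omega)) this.1 this.2

lemma G_ext (D : RootData n) {γ : PreGallery n} (hg : IsGallery D γ) {i m : ℕ}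
    (h : G D m (γ.c i)) : ∀ d, i + d ≤ γ.len → G D (m + d) (γ.c (i + d)) := by
  intro d
  induction d with
  | zero => intro _; exact h
  | succ d ih =>
    intro hi
    have := hg.2.2.2 (i + d + 1) (by omega) hi
    exact G.step (ih (by omega)) this.1 this.2

lemma min_le' (D : RootData n) {γ : PreGallery n} (hmin : IsMinimal D γ) {lam : V n}
    (hfirst : γ.p 0 = {(0 : V n)}) (hlast : γ.p (γ.len + 1) = {lam}) {i m : ℕ} (hi : i ≤ γ.len)
    (h : G D m (γ.c i)) : i ≤ m := by
  have h1 := G_ext D hmin.1 h (γ.len - i) (by omega)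
  rw [show i + (γ.len - i) = γ.len by omega] at h1
  have := min_le D hmin hfirst hlast h1
  omega

/-- Data of the `j`-th wall crossing of a minimal gallery. -/
structure Cross (D : RootData n) (c : ℕ → Set (V n)) (p : ℕ → Set (V n)) (j : ℕ)
    (α u : V n) (k : ℤ) : Prop where
  mem : α ∈ D.Φ
  up : u ∈ p (j + 1)
  u1 : u ∈ c j
  u2 : u ∈ c (j + 1)
  pan : Pan D u α k
  le : c j ⊆ Hle α k
  img : c (j + 1) = sP α k '' c j
  nonneg : 0 ≤ k

lemma cross_ex (D : RootData n) {γ : PreGallery n} (hmin : IsMinimal D γ) {lam : V n}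
    (hfirst : γ.p 0 = {(0 : V n)}) (hlast : γ.p (γ.len + 1) = {lam}) {j : ℕ} (hj : j < γ.len) :
    ∃ α u k, Cross D γ.c γ.p j α u k := by
  obtain ⟨hp, hp'⟩ := hmin.1.2.2.2 (j + 1) (by omega) hj
  simp only [Nat.add_sub_cancel] at hp
  obtain ⟨hpc, u, hu, a, ha, i, hpan, -⟩ := panel_data D hp
  obtain ⟨hpc', -⟩ := panel_data D hp'
  have hG := G_initial D hmin.1 hfirst j (by omega)
  have hne : γ.c (j + 1) ≠ γ.c j := by
    intro e
    rw [← e] at hG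
    have := min_le' D hmin hfirst hlast hj hG
    omega
  obtain ⟨α, hα, k, hpan, hle⟩ : ∃ α ∈ D.Φ, ∃ k : ℤ, Pan D u α k ∧ γ.c j ⊆ Hle α k := by
    rcases side D hp.1 ha i with h | h
    · exact ⟨a, ha, i, hpan, h⟩
    · refine ⟨-a, D.neg_mem a ha, -i, hpan.change (D.neg_mem a ha) ?_, ?_⟩
      · rw [inner_neg_left, hpan.1]; push_cast; rfl
      · rw [Hle_neg]; exact h
  have himg := (adj D hp.1 hp'.1 hα hpan (hpc hu) (hpc' hu)).resolve_left hne
  refine ⟨α, u, k, hα, hu, hpc hu, hpc' hu, hpan, hle, himg, ?_⟩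
  by_contra hk
  obtain ⟨m', hm, hG'⟩ := G_refl D hG hα hle (by omega)
  rw [← himg] at hG'
  have := min_le' D hmin hfirst hlast hj hG'
  omega

/-- Products of subwords of the reflections `r j, …, r (l - 1)`. -/
inductive Tl (l : ℕ) (r : ℕ → Equiv.Perm (V n)) : ℕ → ℕ → Equiv.Perm (V n) → Prop
  | nil : Tl l r l 0 1
  | skip {j m : ℕ} {y : Equiv.Perm (V n)} (hj : j < l) (h : Tl l r (j + 1) m y) : Tl l r j m y
  | fold {j m : ℕ} {y : Equiv.Perm (V n)} (hj : j < l) (h : Tl l r (j + 1) m y) :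
      Tl l r j (m + 1) (r j * y)

lemma tl_exchange (D : RootData n) {l : ℕ} {c p : ℕ → Set (V n)} {a u : ℕ → V n} {b : ℕ → ℤ}
    {lam : V n} (hc : ∀ i ≤ l, IsAlcove D (c i)) (hlam : lam ∈ c l)
    (hcr : ∀ j < l, Cross D c p j (a j) (u j) (b j)) {j m : ℕ} {y : Equiv.Perm (V n)}
    (h : Tl l (fun j => sP (a j) (b j : ℝ)) j m y) :
    ∀ {α : V n} {k : ℤ}, α ∈ D.Φ → c j ⊆ Hle α k → (k : ℝ) < ⟪α, y lam⟫ →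
      Tl l (fun j => sP (a j) (b j : ℝ)) j (m + 1) (sP α k * y) := by
  induction h with
  | nil =>
    intro α k hα h1 h2
    exact absurd (h1 hlam) (not_le.2 h2)
  | @skip j m y hj h ih =>
    intro α k hα h1 h2
    have X := hcr j hj
    rcases side D (hc (j + 1) hj) hα k with h3 | h3
    · exact Tl.skip hj (ih hα h3 h2)
    · have he : ⟪α, u j⟫ = (k : ℝ) := le_antisymm (h1 X.u1) (h3 X.u2)
      have e := Hy_eq_sP D hα X.mem (X.pan.2 α hα k he)
      rw [← e]
      exact Tl.fold (r := fun j => sP (a j) (b j : ℝ)) hj h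
  | @fold j m y hj h ih =>
    intro α k hα h1 h2
    have X := hcr j hj
    obtain ⟨α', hα', k', tr⟩ := trans_pull D (sP_mem D X.mem (b j)) hα k
    have h3 : c (j + 1) ⊆ Hle α' k' := by
      rw [← tr.image_Hle, X.img, sP_image_image]; exact h1
    have h4 : (k' : ℝ) < ⟪α', y lam⟫ := by
      have := tr.1 (y lam)
      have h2 : (k : ℝ) < ⟪α, sP (a j) (b j) (y lam)⟫ := h2
      linarith
    have h5 := Tl.fold (r := fun j => sP (a j) (b j : ℝ)) hj (ih hα' h3 h4)
    have e : sP α k * (sP (a j) (b j) * y) = sP (a j) (b j) * (sP α' k' * y) := by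
      rw [← tr.2]; group
    change Tl l _ j _ (sP α k * (sP (a j) (b j) * y))
    rw [e]
    exact h5

lemma hull_inv (D : RootData n) (lam : V n) {w : Equiv.Perm (V n)} (hw : w ∈ FinW D) {x : V n}
    (hx : x ∈ convexHull ℝ (W0orbit D lam)) : w x ∈ convexHull ℝ (W0orbit D lam) := by
  obtain ⟨L, hL⟩ := finW_linear D hw
  rw [hL]
  have h1 : L x ∈ L '' convexHull ℝ (W0orbit D lam) := ⟨x, hx, rfl⟩
  rw [LinearMap.image_convexHull] at h1
  refine convexHull_mono ?_ h1
  rintro _ ⟨_, ⟨w', hw', rfl⟩, rfl⟩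
  exact ⟨w * w', mul_mem hw hw', by rw [← hL]; rfl⟩

lemma hull_seg (D : RootData n) (lam : V n) {α x : V n} (hα : α ∈ D.Φ) {k : ℝ} (hk : 0 ≤ k)
    (hx : x ∈ convexHull ℝ (W0orbit D lam)) (hkx : k ≤ ⟪α, x⟫) :
    sP α k x ∈ convexHull ℝ (W0orbit D lam) := by
  have h1 := hull_inv D lam (sP_mem0 D hα) hx
  by_cases h0 : ⟪α, x⟫ = (0 : ℝ)
  · rw [sP_fix (by linarith)]; exact hx
  have hpos : 0 < ⟪α, x⟫ := lt_of_le_of_ne (hk.trans hkx) (Ne.symm h0)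
  have h2 := convex_convexHull ℝ (W0orbit D lam) hx h1 (a := k / ⟪α, x⟫)
    (b := (⟪α, x⟫ - k) / ⟪α, x⟫) (by positivity) (div_nonneg (by linarith) hpos.le)
    (by field_simp; ring)
  convert h2 using 1
  rw [sP_apply, sP_apply]
  have e1 : k / ⟪α, x⟫ = 1 - (⟪α, x⟫ - k) / ⟪α, x⟫ := by field_simp; ring
  have e2 : (⟪α, x⟫ - k) = ((⟪α, x⟫ - k) / ⟪α, x⟫) * (⟪α, x⟫ - 0) := by field_simp; ring
  rw [e1]
  generalize (⟪α, x⟫ - k) / ⟪α, x⟫ = t at *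
  rw [e2]
  module

lemma tl_main (D : RootData n) {l : ℕ} {c p : ℕ → Set (V n)} {a u : ℕ → V n} {b : ℕ → ℤ}
    {lam : V n} (hc : ∀ i ≤ l, IsAlcove D (c i)) (hlam : lam ∈ c l)
    (hcr : ∀ j < l, Cross D c p j (a j) (u j) (b j)) :
    ∀ (m d j : ℕ) (y : Equiv.Perm (V n)), l - j ≤ d →
    Tl l (fun j => sP (a j) (b j : ℝ)) j m y → y lam ∈ convexHull ℝ (W0orbit D lam) := by
  intro m
  induction m using Nat.strong_induction_on with
  | _ m IH =>
  intro d
  induction d with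
  | zero =>
    intro j y hd h
    cases h with
    | nil => exact subset_convexHull ℝ _ ⟨1, one_mem _, rfl⟩
    | skip hj h => omega
    | fold hj h => omega
  | succ d ihd =>
    intro j y hd h
    cases h with
    | nil => exact subset_convexHull ℝ _ ⟨1, one_mem _, rfl⟩
    | skip hj h => exact ihd (j + 1) y (by omega) h
    | @fold _ m y hj h =>
      have X := hcr j hj
      by_cases hk : (b j : ℝ) ≤ ⟪a j, y lam⟫
      · exact hull_seg D lam X.mem (by exact_mod_cast X.nonneg)
          (IH m (by omega) (l - (j + 1)) (j + 1) y le_rfl h) hk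
      · push Not at hk
        have h1 : c (j + 1) ⊆ Hle (-(a j)) ((-(b j) : ℤ) : ℝ) := by
          rw [Hle_neg, X.img]
          exact (sP_swap D X.mem (b j) _).2.2 X.le
        have h2 := tl_exchange D hc hlam hcr h (D.neg_mem _ X.mem) h1
          (by rw [inner_neg_left]; push_cast; linarith)
        have e : sP (-(a j)) ((-(b j) : ℤ) : ℝ) = sP (a j) (b j) := by
          push_cast; exact sP_neg ..
        rw [e] at h2
        exact ihd (j + 1) _ (by omega) h2

lemma link (D : RootData n) {γ γ' : PreGallery n} (hg : IsGallery D γ) (hg' : IsGallery D γ')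
    (hty : SameTypeGallery D γ γ') {a u : ℕ → V n} {b : ℕ → ℤ} {lam μ : V n}
    (hcr : ∀ j < γ.len, Cross D γ.c γ.p j (a j) (u j) (b j))
    (hlast : γ.p (γ.len + 1) = {lam}) (hμ : γ'.p (γ'.len + 1) = {μ}) :
    ∀ (d j : ℕ) (x : Equiv.Perm (V n)), j + d = γ.len → x ∈ AffW D → γ'.c j = x '' γ.c j →
      ∃ m y, Tl γ.len (fun j => sP (a j) (b j : ℝ)) j m y ∧ μ = x (y lam) := by
  have hl := hty.1
  intro d
  induction d with
  | zero =>
    intro j x hj hx hxc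
    obtain rfl : j = γ.len := by omega
    refine ⟨0, 1, Tl.nil, ?_⟩
    obtain ⟨z, hz, hzz⟩ := hty.2 (γ.len + 1) le_rfl
    rw [hlast, hl, hμ, Set.image_singleton, Set.singleton_eq_singleton_iff] at hzz
    have hmc : μ ∈ γ'.c γ.len := by
      rw [hl]; apply hg'.2.2.1.2; rw [hμ]; rfl
    have hlc : lam ∈ γ.c γ.len := by
      apply hg.2.2.1.2; rw [hlast]; rfl
    have hxl : x lam ∈ γ'.c γ.len := by rw [hxc]; exact ⟨lam, hlc, rfl⟩
    have e : (z * x⁻¹) (x lam) = μ := by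
      change z (x⁻¹ (x lam)) = μ
      rw [inv_ap, hzz]
    have := strict D (hg'.1 _ hl.le) (mul_mem hz (inv_mem hx)) hxl (by rw [e]; exact hmc)
    rw [e] at this
    exact this
  | succ d ih =>
    intro j x hj hx hxc
    have hjl : j < γ.len := by omega
    have X := hcr j hjl
    obtain ⟨hp, -⟩ := hg.2.2.2 (j + 1) (by omega) hjl
    obtain ⟨hq, hq'⟩ := hg'.2.2.2 (j + 1) (by omega) (by omega)
    simp only [Nat.add_sub_cancel] at hp hq
    obtain ⟨z, hz, hzz⟩ := hty.2 (j + 1) (by omega)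
    have hpe : γ'.p (j + 1) = x '' γ.p (j + 1) := by
      have h1 : (z * x⁻¹) '' (x '' γ.p (j + 1)) = γ'.p (j + 1) := by
        rw [← Set.image_comp, ← Equiv.Perm.coe_mul, inv_mul_cancel_right, hzz]
      have h2 := strict_set D hq.1 (mul_mem hz (inv_mem hx)) (p := x '' γ.p (j + 1))
        (by rw [hxc]; exact Set.image_mono (panel_data D hp).1)
        (by rw [h1]; exact (panel_data D hq).1)
      rw [h1] at h2
      exact h2
    obtain ⟨α, hα, k, tr⟩ := trans_ex D hx X.mem (b j)
    have hpan := pan_image D hx tr X.pan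
    have hxu : x (u j) ∈ γ'.p (j + 1) := by rw [hpe]; exact ⟨_, X.up, rfl⟩
    rcases adj D hq.1 hq'.1 hα hpan ((panel_data D hq).1 hxu) ((panel_data D hq').1 hxu) with h | h
    · obtain ⟨m, y, hT, hm⟩ := ih (j + 1) (x * sP (a j) (b j)) (by omega)
        (mul_mem hx (sP_mem D X.mem _)) (by
          rw [h, hxc, X.img, Equiv.Perm.coe_mul, Set.image_comp, sP_image_image])
      exact ⟨m + 1, _, Tl.fold hjl hT, hm⟩
    · obtain ⟨m, y, hT, hm⟩ := ih (j + 1) x (by omega) hx (by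
          rw [h, hxc, X.img, ← tr.2]
          simp only [← Set.image_comp, ← Equiv.Perm.coe_mul]
          rw [inv_mul_cancel_right])
      exact ⟨m, _, Tl.skip hjl hT, hm⟩

end Shd

/-- Lemma: the shadow of a coroot lattice element with respect to *any*
orientation is contained in the `λ`-Weyl polytope. -/
theorem shadow_any_orientation_in_weylPolytope {n : ℕ} (D : RootData n)
    (lam : V n) (hlam : lam ∈ corootLattice D)
    (φ : Set (V n) → Set (V n) → Prop)
    (γ : PreGallery n) (hmin : IsMinimal D γ)
    (hfirst : γ.p 0 = {(0 : V n)}) (hlast : γ.p (γ.len + 1) = {lam})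
    (γ' : PreGallery n) (hγ' : IsGallery D γ') (hty : SameTypeGallery D γ γ')
    (hfirst' : γ'.p 0 = {(0 : V n)}) (hpos : PositivelyFolded φ γ')
    (μ : V n) (hμ : γ'.p (γ'.len + 1) = {μ}) :
    μ ∈ convexHull ℝ (W0orbit D lam) := by
  have hg := hmin.1
  have hex : ∀ j, ∃ q : V n × V n × ℤ, j < γ.len → Shd.Cross D γ.c γ.p j q.1 q.2.1 q.2.2 := by
    intro j
    by_cases hj : j < γ.len
    · obtain ⟨a, u, k, h⟩ := Shd.cross_ex D hmin hfirst hlast hj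
      exact ⟨(a, u, k), fun _ => h⟩
    · exact ⟨(0, 0, 0), fun h => absurd h hj⟩
  choose q hq using hex
  obtain ⟨g1, hg1, e1⟩ := Shd.alcove_trans D (hg.1 0 (by omega))
  obtain ⟨g2, hg2, e2⟩ := Shd.alcove_trans D (hγ'.1 0 (by omega))
  have h0 : (0 : V n) ∈ γ.c 0 := hg.2.1.2 (by rw [hfirst]; rfl)
  have h0' : (0 : V n) ∈ γ'.c 0 := hγ'.2.1.2 (by rw [hfirst']; rfl)
  have hx : g2 * g1⁻¹ ∈ AffW D := mul_mem hg2 (inv_mem hg1)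
  have hxc : γ'.c 0 = (g2 * g1⁻¹) '' γ.c 0 := by
    rw [e1, e2, ← Set.image_comp, ← Equiv.Perm.coe_mul, inv_mul_cancel_right]
  generalize g2 * g1⁻¹ = x at hx hxc
  have hx0 : x 0 = 0 := by
    have h1 : x 0 ∈ γ'.c 0 := by rw [hxc]; exact ⟨0, h0, rfl⟩
    have := Shd.strict D (hγ'.1 0 (by omega)) (inv_mem hx) h1 (by rw [Shd.inv_ap]; exact h0')
    rw [Shd.inv_ap] at this
    exact this.symm
  obtain ⟨m, y, hT, hm⟩ := Shd.link D hg hγ' hty (a := fun j => (q j).1) (u := fun j => (q j).2.1)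
    (b := fun j => (q j).2.2) hq hlast hμ γ.len 0 x (by omega) hx hxc
  rw [hm]
  apply Shd.hull_inv D lam (Shd.mem_finW_of_fix D hx hx0)
  exact Shd.tl_main D (a := fun j => (q j).1) (u := fun j => (q j).2.1)
    (b := fun j => (q j).2.2) hg.1 (hg.2.2.1.2 (by rw [hlast]; rfl)) hq m _ 0 y le_rfl hT
end
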